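/- (Cardin–Viterbo rigidity.) Let n ≥ 1 and let F, G ∈ C_c^∞(ℝ^{2n}) with {F,G} not identically zero. Then there exist ε > 0 and δ > 0 such that every pair F', G' ∈ C_c^∞(ℝ^{2n}) with ‖F' − F‖ < δ and ‖G' − G‖ < δ satisfies ‖{F',G'}‖ ≥ ε. In particular, the liminf of ‖{F',G'}‖ over F',G' → F,G in the uniform norm is strictly positive. -/

import Mathlib

/-- The phase space `ℝ^{2n} = ℝ^n × ℝ^n` with coordinates `(p, q)`. -/
abbrev Phase (n : ℕ) := (Fin n → ℝ) × (Fin n → ℝ)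

/-- Partial derivative `∂F/∂p_i`. -/
noncomputable def pderivP {n : ℕ} (F : Phase n → ℝ) (i : Fin n) (x : Phase n) : ℝ :=
  fderiv ℝ F x (Pi.single i 1, 0)

/-- Partial derivative `∂F/∂q_i`. -/
noncomputable def pderivQ {n : ℕ} (F : Phase n → ℝ) (i : Fin n) (x : Phase n) : ℝ :=
  fderiv ℝ F x (0, Pi.single i 1)

/-- The standard Poisson bracket
`{F,G} = Σ i, (∂F/∂q_i · ∂G/∂p_i − ∂F/∂p_i · ∂G/∂q_i)`. -/
noncomputable def poisson {n : ℕ} (F G : Phase n → ℝ) (x : Phase n) : ℝ :=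
  ∑ i : Fin n, (pderivQ F i x * pderivP G i x - pderivP F i x * pderivQ G i x)

/-- `F ∈ C_c^∞(ℝ^{2n})`: smooth and compactly supported. -/
def SmoothCpt {n : ℕ} (F : Phase n → ℝ) : Prop :=
  ContDiff ℝ (⊤ : ℕ∞) F ∧ HasCompactSupport F

/-- The uniform (C⁰) norm `‖F‖ = sup_x |F x|`. -/
noncomputable def unif {n : ℕ} (F : Phase n → ℝ) : ℝ := ⨆ x, |F x|

namespace CV
open MeasureTheory Polynomial

/-- For small `t`, the map `id + t g` is a diffeomorphism preserving a big ball; hence the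
change of variables formula holds without absolute value. -/
lemma brouwer_small {d : ℕ} {g : EuclideanSpace ℝ (Fin d) → EuclideanSpace ℝ (Fin d)}
    (hg : ContDiff ℝ 1 g) {K : NNReal} (hK : LipschitzWith K g) {R : ℝ}
    (hR : ∀ x, R < ‖x‖ → g x = 0) {t : ℝ} (ht0 : 0 ≤ t) (ht : t * K < 1)
    (φ : EuclideanSpace ℝ (Fin d) → ℝ) :
    ∫ x in Metric.closedBall 0 R, φ (x + t • g x) *
      (ContinuousLinearMap.id ℝ _ + t • fderiv ℝ g x).det = ∫ x in Metric.closedBall 0 R, φ x := by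
  have hgd : Differentiable ℝ g := hg.differentiable (by norm_num)
  have hgK : ∀ x y, ‖g x - g y‖ ≤ K * ‖x - y‖ := fun x y => hK.norm_sub_le x y
  set f : EuclideanSpace ℝ (Fin d) → EuclideanSpace ℝ (Fin d) := fun x => x + t • g x with hf
  have hinj : Function.Injective f := by
    intro x y hxy
    have h1 : x - y = - (t • (g x - g y)) := by
      simp only [hf] at hxy
      rw [smul_sub]
      have : x = y + t • g y - t • g x := by rw [← hxy]; abel
      nth_rewrite 1 [this]; abel
    have h2 : ‖x - y‖ ≤ t * (K * ‖x - y‖) := by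
      nth_rewrite 1 [h1]
      rw [norm_neg, norm_smul, Real.norm_of_nonneg ht0]
      exact mul_le_mul_of_nonneg_left (hgK x y) ht0
    have h3 : ‖x - y‖ ≤ 0 := by
      by_contra h
      push Not at h
      nlinarith
    exact sub_eq_zero.1 (norm_le_zero_iff.1 h3)
  have hsurj : Function.Surjective f := by
    intro y
    have hc : ContractingWith (Real.toNNReal t * K) (fun x => y - t • g x) := by
      refine ⟨?_, ?_⟩
      · rw [← NNReal.coe_lt_coe]; simpa [ht0] using ht
      · refine LipschitzWith.of_dist_le_mul fun a b => ?_
        rw [dist_eq_norm, dist_eq_norm]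
        have : y - t • g a - (y - t • g b) = - (t • (g a - g b)) := by rw [smul_sub]; abel
        rw [this, norm_neg, norm_smul, Real.norm_of_nonneg ht0]
        push_cast
        rw [Real.coe_toNNReal _ ht0, mul_assoc]
        exact mul_le_mul_of_nonneg_left (hgK a b) ht0
    refine ⟨hc.fixedPoint, ?_⟩
    have h := hc.fixedPoint_isFixedPt
    simp only [Function.IsFixedPt] at h
    simp only [hf]
    nth_rewrite 1 [← h]
    abel
  have himg : f '' (Metric.closedBall 0 R) = Metric.closedBall 0 R := by
    have hout : ∀ x, x ∉ Metric.closedBall (0 : EuclideanSpace ℝ (Fin d)) R → f x = x := by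
      intro x hx
      have : R < ‖x‖ := by simpa using hx
      simp [hf, hR x this]
    ext z
    constructor
    · rintro ⟨x, hx, rfl⟩
      by_contra h
      have := hout _ h
      rw [hinj this] at h
      exact h hx
    · intro hz
      obtain ⟨x, rfl⟩ := hsurj z
      refine ⟨x, ?_, rfl⟩
      by_contra h
      rw [hout x h] at hz
      exact h hz
  have hder : ∀ x, HasFDerivAt f (ContinuousLinearMap.id ℝ _ + t • fderiv ℝ g x) x := by
    intro x
    exact (hasFDerivAt_id x).add ((hgd x).hasFDerivAt.const_smul t)
  have hdet : ∀ x, 0 < (ContinuousLinearMap.id ℝ _ + t • fderiv ℝ g x).det := by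
    intro x
    have hA : ‖fderiv ℝ g x‖ ≤ K := norm_fderiv_le_of_lipschitz ℝ hK
    have hne : ∀ s ∈ Set.Icc 0 t, (ContinuousLinearMap.id ℝ _ + s • fderiv ℝ g x).det ≠ 0 := by
      intro s hs h0
      obtain ⟨v, hv, hv0⟩ := (Submodule.ne_bot_iff _).1
        (LinearMap.bot_lt_ker_of_det_eq_zero h0).ne'
      rw [LinearMap.mem_ker] at hv
      have hv' : v + s • fderiv ℝ g x v = 0 := by simpa using hv
      have h1 : ‖v‖ ≤ s * (K * ‖v‖) := by
        have : v = - (s • fderiv ℝ g x v) := eq_neg_of_add_eq_zero_left hv'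
        nth_rewrite 1 [this]
        rw [norm_neg, norm_smul, Real.norm_of_nonneg hs.1]
        refine mul_le_mul_of_nonneg_left ?_ hs.1
        exact (ContinuousLinearMap.le_opNorm _ _).trans
          (mul_le_mul_of_nonneg_right hA (norm_nonneg _))
      have h2 : 0 < ‖v‖ := norm_pos_iff.2 hv0
      have h3 : s * K ≤ t * K := mul_le_mul_of_nonneg_right hs.2 K.2
      nlinarith
    have hcont : ContinuousOn (fun s : ℝ => (ContinuousLinearMap.id ℝ _ + s • fderiv ℝ g x).det)
        (Set.Icc 0 t) := by
      have : Continuous (fun s : ℝ => (ContinuousLinearMap.id ℝ (EuclideanSpace ℝ (Fin d))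
          + s • fderiv ℝ g x).det) :=
        ContinuousLinearMap.continuous_det.comp (by fun_prop)
      exact this.continuousOn
    by_contra hneg
    push Not at hneg
    have := intermediate_value_Icc' ht0 hcont
    obtain ⟨s, hs, hs0⟩ := this ⟨hneg, by simp [ContinuousLinearMap.det]⟩
    exact hne s hs hs0
  have := integral_image_eq_integral_abs_det_fderiv_smul (volume)
    (Metric.isClosed_closedBall (x := (0 : EuclideanSpace ℝ (Fin d))) (ε := R)).measurableSet
    (fun x _ => (hder x).hasFDerivWithinAt) (hinj.injOn) φ
  rw [himg] at this
  rw [this]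
  refine integral_congr_ae (Filter.Eventually.of_forall fun x => ?_)
  simp only [smul_eq_mul]
  rw [abs_of_pos (hdet x), mul_comm]

lemma brouwer_poly_det {d : ℕ}
    (A : EuclideanSpace ℝ (Fin d) →L[ℝ] EuclideanSpace ℝ (Fin d)) :
    ∃ P : ℝ[X], P.natDegree ≤ d ∧ ∀ t, P.eval t = (ContinuousLinearMap.id ℝ _ + t • A).det := by
  let b := (EuclideanSpace.basisFun (Fin d) ℝ).toBasis
  let M := LinearMap.toMatrix b b (A : EuclideanSpace ℝ (Fin d) →ₗ[ℝ] EuclideanSpace ℝ (Fin d))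
  refine ⟨((X : ℝ[X]) • M.map C + (1 : Matrix (Fin d) (Fin d) ℝ).map C).det, ?_, ?_⟩
  · simpa using natDegree_det_X_add_C_le M 1
  · intro t
    rw [ContinuousLinearMap.det, ← LinearMap.det_toMatrix b, ← Polynomial.coe_evalRingHom,
      RingHom.map_det]
    congr 1
    ext i j
    simp only [RingHom.mapMatrix_apply, Matrix.map_apply, Matrix.add_apply, Matrix.smul_apply,
      coe_evalRingHom, eval_add, smul_eq_mul, eval_mul, eval_X, eval_C]
    have : LinearMap.toMatrix b b
        (((ContinuousLinearMap.id ℝ _ + t • A) : EuclideanSpace ℝ (Fin d) →L[ℝ] _) :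
          EuclideanSpace ℝ (Fin d) →ₗ[ℝ] EuclideanSpace ℝ (Fin d)) = 1 + t • M := by
      rw [ContinuousLinearMap.toLinearMap_add, map_add, ContinuousLinearMap.toLinearMap_smul, map_smul,
        ContinuousLinearMap.coe_id, LinearMap.toMatrix_id]
    rw [this]
    simp only [Matrix.add_apply, Matrix.smul_apply, smul_eq_mul]
    ring

/-- Polynomial identity in `t`: extends from small `t` to `t = 1`. -/
lemma brouwer_one {d : ℕ} {g : EuclideanSpace ℝ (Fin d) → EuclideanSpace ℝ (Fin d)}
    (hg : ContDiff ℝ 1 g) {K : NNReal} (hK : LipschitzWith K g) {R : ℝ}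
    (hR : ∀ x, R < ‖x‖ → g x = 0) (y : EuclideanSpace ℝ (Fin d)) (S : ℝ) (k : ℕ) :
    ∫ x in Metric.closedBall 0 R, (1 - ‖x + g x - y‖ ^ 2 / S) ^ k *
      (ContinuousLinearMap.id ℝ _ + fderiv ℝ g x).det
      = ∫ x in Metric.closedBall 0 R, (1 - ‖x - y‖ ^ 2 / S) ^ k := by
  set D := 2 * k + d with hD
  have hpoly : ∀ x, ∃ P : ℝ[X], P.natDegree ≤ D ∧ ∀ t, P.eval t =
      (1 - ‖x + t • g x - y‖ ^ 2 / S) ^ k *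
        (ContinuousLinearMap.id ℝ _ + t • fderiv ℝ g x).det := by
    intro x
    obtain ⟨P, hP, hPe⟩ := brouwer_poly_det (fderiv ℝ g x)
    let q : ℝ[X] := C (1 - ‖x - y‖ ^ 2 / S) + C (- (2 * inner ℝ (x - y) (g x)) / S) * X
      + C (- ‖g x‖ ^ 2 / S) * X ^ 2
    refine ⟨q ^ k * P, ?_, ?_⟩
    · have hq : q.natDegree ≤ 2 := by
        simp only [q]; compute_degree
      calc (q ^ k * P).natDegree ≤ (q ^ k).natDegree + P.natDegree := natDegree_mul_le
        _ ≤ k * 2 + d := by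
          gcongr
          exact natDegree_pow_le.trans (Nat.mul_le_mul_left _ hq)
        _ = D := by rw [hD]; ring
    · intro t
      rw [eval_mul, eval_pow, hPe]
      congr 2
      have : x + t • g x - y = (x - y) + t • g x := by abel
      rw [this, norm_add_sq_real, inner_smul_right, norm_smul, mul_pow, Real.norm_eq_abs, sq_abs]
      simp only [q, eval_add, eval_mul, eval_C, eval_X, eval_pow]
      ring
  choose P hPd hPe using hpoly
  set t₀ : ℝ := 1 / (K + 1) with ht₀
  have ht₀pos : 0 < t₀ := by positivity
  let v : ℕ → ℝ := fun i => t₀ * (i / (D + 1))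
  have hv : Set.InjOn v (Finset.range (D + 1)) := by
    intro i _ j _ hij
    simp only [v] at hij
    have h1 := mul_left_cancel₀ ht₀pos.ne' hij
    have h2 : ((D : ℝ) + 1) ≠ 0 := by positivity
    field_simp at h1
    exact_mod_cast h1
  have hvle : ∀ i ∈ Finset.range (D + 1), 0 ≤ v i ∧ v i * K < 1 := by
    intro i hi
    have hi' : (i : ℝ) / (D + 1) ≤ 1 := by
      rw [div_le_one (by positivity)]
      have := Finset.mem_range.1 hi
      exact_mod_cast this.le
    refine ⟨by positivity, ?_⟩
    have h1 : v i ≤ t₀ := by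
      simp only [v]; nlinarith
    calc v i * K ≤ t₀ * K := mul_le_mul_of_nonneg_right h1 K.2
      _ < 1 := by
        rw [ht₀, one_div, inv_mul_lt_iff₀ (by positivity)]
        linarith
  have hIntg : ∀ t : ℝ, IntegrableOn (fun x => (P x).eval t) (Metric.closedBall 0 R) := by
    intro t
    have hc : Continuous (fun x => (P x).eval t) := by
      simp_rw [hPe]
      have h1 : Continuous g := hg.continuous
      have h2 : Continuous (fderiv ℝ g) := hg.continuous_fderiv (by norm_num)
      have h3 : Continuous fun x =>
          (ContinuousLinearMap.id ℝ (EuclideanSpace ℝ (Fin d)) + t • fderiv ℝ g x).det :=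
        ContinuousLinearMap.continuous_det.comp (by fun_prop)
      fun_prop
    exact hc.continuousOn.integrableOn_compact (isCompact_closedBall _ _)
  have hinterp : ∀ x, (P x).eval 1 = ∑ i ∈ Finset.range (D + 1),
      (P x).eval (v i) * (Lagrange.basis (Finset.range (D + 1)) v i).eval 1 := by
    intro x
    have hdeg : (P x).degree < (Finset.range (D + 1)).card := by
      rw [Finset.card_range]
      refine degree_le_natDegree.trans_lt ?_
      exact_mod_cast Nat.lt_succ_of_le (hPd x)
    have h1 := Lagrange.eq_interpolate hv hdeg
    have h2 := congrArg (eval 1) h1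
    rw [Lagrange.interpolate_apply, eval_finsetSum] at h2
    rw [h2]
    refine Finset.sum_congr rfl fun i _ => ?_
    rw [eval_mul, eval_C]
  have hfin : ∫ x in Metric.closedBall 0 R, (P x).eval 1
      = ∫ x in Metric.closedBall 0 R, (1 - ‖x - y‖ ^ 2 / S) ^ k := by
    simp_rw [hinterp]
    rw [integral_finsetSum _ (fun i _ => (hIntg (v i)).mul_const _)]
    have h3 : ∀ i ∈ Finset.range (D + 1), ∫ x in Metric.closedBall 0 R,
        (P x).eval (v i) * (Lagrange.basis (Finset.range (D + 1)) v i).eval 1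
        = (∫ x in Metric.closedBall 0 R, (1 - ‖x - y‖ ^ 2 / S) ^ k) *
          (Lagrange.basis (Finset.range (D + 1)) v i).eval 1 := by
      intro i hi
      rw [integral_mul_const]
      congr 1
      simp_rw [hPe]
      exact brouwer_small hg hK hR (hvle i hi).1 (hvle i hi).2 (fun x => (1 - ‖x - y‖ ^ 2 / S) ^ k)
    rw [Finset.sum_congr rfl h3, ← Finset.mul_sum, ← eval_finsetSum,
      Lagrange.sum_basis hv ⟨0, by simp⟩, eval_one, mul_one]
  rw [← hfin]
  refine integral_congr_ae (Filter.Eventually.of_forall fun x => ?_)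
  simp only [hPe, one_smul]

lemma brouwer_surj {d : ℕ} {g : EuclideanSpace ℝ (Fin d) → EuclideanSpace ℝ (Fin d)}
    (hg : ContDiff ℝ 1 g) (hc : HasCompactSupport g) :
    Function.Surjective (fun x => x + g x) := by
  intro y
  by_contra hy
  push Not at hy
  obtain ⟨K, hK⟩ := ContDiff.lipschitzWith_of_hasCompactSupport hc hg (by norm_num)
  obtain ⟨R₀, hR₀⟩ := hc.isBounded.subset_closedBall 0
  set R := max R₀ (‖y‖ + 1) with hRdef
  have hR : ∀ x, R < ‖x‖ → g x = 0 := by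
    intro x hx
    by_contra h
    have h1 := hR₀ (subset_tsupport _ (Function.mem_support.2 h))
    rw [mem_closedBall_zero_iff] at h1
    have := le_max_left R₀ (‖y‖ + 1)
    linarith
  set B := Metric.closedBall (0 : EuclideanSpace ℝ (Fin d)) R with hB
  have hBc : IsCompact B := isCompact_closedBall _ _
  have hyB : y ∈ B := by
    rw [hB, mem_closedBall_zero_iff]
    have := le_max_right R₀ (‖y‖ + 1)
    linarith
  have hgc := hg.continuous
  have hfc : Continuous fun x => ‖x + g x - y‖ := by fun_prop
  obtain ⟨x₁, _, hx₁⟩ := hBc.exists_isMinOn ⟨y, hyB⟩ hfc.continuousOn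
  set ρ := min 1 ‖x₁ + g x₁ - y‖ with hρ
  have hρpos : 0 < ρ := lt_min one_pos (norm_pos_iff.2 (sub_ne_zero.2 (hy x₁)))
  have hρle : ∀ x ∈ B, ρ ≤ ‖x + g x - y‖ := fun x hx => (min_le_right _ _).trans (hx₁ hx)
  obtain ⟨S₁, hS₁⟩ := hBc.exists_bound_of_continuousOn (f := fun x => ‖x + g x - y‖ ^ 2)
    (by fun_prop)
  obtain ⟨S₂, hS₂⟩ := hBc.exists_bound_of_continuousOn (f := fun x => ‖x - y‖ ^ 2)
    (by fun_prop)
  set S := max 1 (max S₁ S₂) with hS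
  have hSpos : 0 < S := lt_of_lt_of_le one_pos (le_max_left _ _)
  have hS1 : ∀ x ∈ B, ‖x + g x - y‖ ^ 2 ≤ S := fun x hx => by
    have := hS₁ x hx
    rw [Real.norm_of_nonneg (by positivity)] at this
    exact this.trans ((le_max_left _ _).trans (le_max_right _ _))
  have hS2 : ∀ x ∈ B, ‖x - y‖ ^ 2 ≤ S := fun x hx => by
    have := hS₂ x hx
    rw [Real.norm_of_nonneg (by positivity)] at this
    exact this.trans ((le_max_right _ _).trans (le_max_right _ _))
  set α := 1 - ρ ^ 2 / 4 / S with hα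
  set β := 1 - ρ ^ 2 / S with hβ
  have hρS : ρ ^ 2 ≤ S := (pow_le_pow_left₀ hρpos.le (hρle y hyB) 2).trans (hS1 y hyB)
  have hβ0 : 0 ≤ β := by
    rw [hβ, sub_nonneg, div_le_one hSpos]; exact hρS
  have hβα : β < α := by
    rw [hα, hβ]
    have : ρ ^ 2 / 4 / S < ρ ^ 2 / S := by
      apply div_lt_div_of_pos_right _ hSpos
      nlinarith [pow_pos hρpos 2]
    linarith
  have hαpos : 0 < α := lt_of_le_of_lt hβ0 hβα
  let J : EuclideanSpace ℝ (Fin d) → ℝ := fun x =>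
    (ContinuousLinearMap.id ℝ (EuclideanSpace ℝ (Fin d)) + fderiv ℝ g x).det
  have hJc : Continuous J := by
    have h2 : Continuous (fderiv ℝ g) := hg.continuous_fderiv (by norm_num)
    exact ContinuousLinearMap.continuous_det.comp (by fun_prop)
  obtain ⟨CJ, hCJ⟩ := hBc.exists_bound_of_continuousOn hJc.continuousOn
  have hCJ0 : 0 ≤ CJ := (norm_nonneg _).trans (hCJ y hyB)
  have hub : ∀ k : ℕ, ∫ x in B, (1 - ‖x - y‖ ^ 2 / S) ^ k ≤ CJ * volume.real B * β ^ k := by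
    intro k
    rw [← brouwer_one hg hK hR y S k]
    have : ‖∫ x in B, (1 - ‖x + g x - y‖ ^ 2 / S) ^ k * J x‖ ≤ (β ^ k * CJ) * volume.real B := by
      apply norm_setIntegral_le_of_norm_le_const hBc.measure_lt_top
      intro x hx
      rw [norm_mul]
      have h0 : 0 ≤ 1 - ‖x + g x - y‖ ^ 2 / S := by
        rw [sub_nonneg, div_le_one hSpos]; exact hS1 x hx
      have h1 : 1 - ‖x + g x - y‖ ^ 2 / S ≤ β := by
        rw [hβ]
        have := pow_le_pow_left₀ hρpos.le (hρle x hx) 2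
        gcongr
      refine mul_le_mul ?_ (hCJ x hx) (norm_nonneg _) (by positivity)
      rw [Real.norm_of_nonneg (by positivity)]
      exact pow_le_pow_left₀ h0 h1 k
    calc _ ≤ _ := (le_abs_self _).trans this
      _ = _ := by ring
  have hlb : ∀ k : ℕ, volume.real (Metric.ball y (ρ / 2)) * α ^ k
      ≤ ∫ x in B, (1 - ‖x - y‖ ^ 2 / S) ^ k := by
    intro k
    have hsub : Metric.ball y (ρ / 2) ⊆ B := by
      intro x hx
      rw [mem_ball_iff_norm] at hx
      rw [hB, mem_closedBall_zero_iff]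
      have h1 : ‖x‖ ≤ ‖x - y‖ + ‖y‖ := by
        simpa using norm_add_le (x - y) y
      have h2 := le_max_right R₀ (‖y‖ + 1)
      have h3 : ρ ≤ 1 := min_le_left _ _
      linarith
    have hcI : IntegrableOn (fun x => (1 - ‖x - y‖ ^ 2 / S) ^ k) B :=
      (by fun_prop : Continuous fun x : EuclideanSpace ℝ (Fin d) =>
        (1 - ‖x - y‖ ^ 2 / S) ^ k).continuousOn.integrableOn_compact hBc
    calc volume.real (Metric.ball y (ρ / 2)) * α ^ k
        = ∫ x in Metric.ball y (ρ / 2), α ^ k := by rw [setIntegral_const, smul_eq_mul]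
      _ ≤ ∫ x in Metric.ball y (ρ / 2), (1 - ‖x - y‖ ^ 2 / S) ^ k := by
        apply setIntegral_mono_on _ (hcI.mono_set hsub) Metric.isOpen_ball.measurableSet
        · intro x hx
          rw [mem_ball_iff_norm] at hx
          apply pow_le_pow_left₀ hαpos.le
          rw [hα]
          have : ‖x - y‖ ^ 2 ≤ ρ ^ 2 / 4 := by
            have := pow_le_pow_left₀ (norm_nonneg _) hx.le 2
            nlinarith
          gcongr
        · exact integrableOn_const (hs := measure_ball_lt_top.ne)
      _ ≤ _ := by
        apply setIntegral_mono_set hcI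
        · refine (ae_restrict_iff' hBc.measurableSet).2 (Filter.Eventually.of_forall fun x hx => ?_)
          have h0 : 0 ≤ 1 - ‖x - y‖ ^ 2 / S := by
            rw [sub_nonneg, div_le_one hSpos]; exact hS2 x hx
          exact pow_nonneg h0 k
        · exact hsub.eventuallyLE
  have hvpos : 0 < volume.real (Metric.ball y (ρ / 2)) :=
    ENNReal.toReal_pos (Metric.measure_ball_pos volume y (by positivity)).ne'
      measure_ball_lt_top.ne
  set v := volume.real (Metric.ball y (ρ / 2))
  set c := CJ * volume.real B
  have hc0 : 0 ≤ c := mul_nonneg hCJ0 measureReal_nonneg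
  obtain ⟨k, hk⟩ := exists_pow_lt_of_lt_one (x := v / (c + 1)) (y := β / α) (by positivity)
    ((div_lt_one hαpos).2 hβα)
  have h1 := (hlb k).trans (hub k)
  rw [div_pow, div_lt_div_iff₀ (by positivity) (by positivity)] at hk
  have := pow_nonneg hβ0 k
  nlinarith

/-- A `C¹` map of a finite-dimensional space at bounded distance from the identity is onto. -/
lemma surj_of_bounded {E : Type*} [NormedAddCommGroup E] [NormedSpace ℝ E]
    [FiniteDimensional ℝ E] {f : E → E} (hf : ContDiff ℝ 1 f) {C : ℝ}
    (hC : ∀ x, ‖f x - x‖ ≤ C) : Function.Surjective f := by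
  intro y
  let e := toEuclidean (E := E)
  have hC0 : 0 ≤ C := (norm_nonneg _).trans (hC y)
  let χ : ContDiffBump y := ⟨C + 1, C + 2, by linarith, by linarith⟩
  let g : EuclideanSpace ℝ (Fin (Module.finrank ℝ E)) → EuclideanSpace ℝ (Fin (Module.finrank ℝ E)) :=
    fun z => e (χ (e.symm z) • (f (e.symm z) - e.symm z))
  have hg : ContDiff ℝ 1 g := by
    have h1 : ContDiff ℝ 1 (fun z => e.symm z) := e.symm.contDiff
    refine e.contDiff.comp ?_
    exact (χ.contDiff.comp h1).smul ((hf.comp h1).sub h1)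
  have hgc : HasCompactSupport g := by
    refine HasCompactSupport.of_support_subset_isCompact
      ((isCompact_closedBall y (C + 2)).image e.continuous) ?_
    intro z hz
    refine ⟨e.symm z, ?_, by simp⟩
    by_contra h
    apply hz
    have : χ (e.symm z) = 0 := by
      apply χ.zero_of_le_dist
      have : ¬ dist (e.symm z) y ≤ C + 2 := h
      exact (not_le.1 this).le
    simp [g, this]
  obtain ⟨z, hz⟩ := brouwer_surj hg hgc (e y)
  refine ⟨e.symm z, ?_⟩
  have hz' : e.symm z + χ (e.symm z) • (f (e.symm z) - e.symm z) = y := by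
    have := congrArg e.symm hz
    simpa [g] using this
  set x := e.symm z
  have h1 : x ∈ Metric.closedBall y (C + 1) := by
    rw [mem_closedBall_iff_norm]
    have : x - y = - (χ x • (f x - x)) := by
      rw [sub_eq_iff_eq_add, neg_add_eq_sub, eq_sub_iff_add_eq]
      exact hz'
    rw [this, norm_neg, norm_smul, Real.norm_of_nonneg χ.nonneg]
    have := hC x
    have h2 := χ.le_one (x := x)
    have h3 := χ.nonneg (x := x)
    nlinarith [norm_nonneg (f x - x)]
  have h2 : χ x = 1 := χ.one_of_mem_closedBall h1
  rw [h2, one_smul] at hz'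
  simpa using hz'

end CV

namespace CV

/-- The differential in coordinates. -/
noncomputable def lin {n : ℕ} (A : Phase n → ℝ) (x w : Phase n) : ℝ :=
  ∑ i, (w.1 i * pderivP A i x + w.2 i * pderivQ A i x)

/-- Smooth functions with uniform bounds on the function, its gradient and its Hessian. -/
structure Bd {n : ℕ} (C : ℝ) (A : Phase n → ℝ) : Prop where
  smooth : ContDiff ℝ (⊤ : ℕ∞) A
  nonneg : 0 ≤ C
  bd : ∀ x, |A x| ≤ C
  lip : ∀ x y, |A x - A y| ≤ C * ‖x - y‖
  dp : ∀ i x, |pderivP A i x| ≤ C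
  dq : ∀ i x, |pderivQ A i x| ≤ C
  lp : ∀ i x y, |pderivP A i x - pderivP A i y| ≤ C * ‖x - y‖
  lq : ∀ i x y, |pderivQ A i x - pderivQ A i y| ≤ C * ‖x - y‖
  tay : ∀ x w, |A (x + w) - A x - lin A x w| ≤ C * ‖w‖ ^ 2

lemma fderiv_eq_lin {n : ℕ} (A : Phase n → ℝ) (x w : Phase n) : fderiv ℝ A x w = lin A x w := by
  have hw : w = ∑ i, (w.1 i • ((Pi.single i 1, 0) : Phase n) + w.2 i • ((0, Pi.single i 1) : Phase n)) := by
    ext k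
    · simp [Prod.fst_sum, Finset.sum_apply, Pi.single_apply]
    · simp [Prod.snd_sum, Finset.sum_apply, Pi.single_apply]
  conv_lhs => rw [hw]
  simp only [map_sum, map_add, map_smul, smul_eq_mul, lin, pderivP, pderivQ]

lemma norm_eP {n : ℕ} (i : Fin n) : ‖((Pi.single i 1, 0) : Phase n)‖ ≤ 1 := by
  rw [Prod.norm_def]; simp [Pi.norm_single]
lemma norm_eQ {n : ℕ} (i : Fin n) : ‖((0, Pi.single i 1) : Phase n)‖ ≤ 1 := by
  rw [Prod.norm_def]; simp [Pi.norm_single]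

lemma SmoothCpt.exists_bd {n : ℕ} {A : Phase n → ℝ} (hA : SmoothCpt A) : ∃ C, Bd C A := by
  obtain ⟨hs, hc⟩ := hA
  have h1 : ContDiff ℝ 1 (fderiv ℝ A) := hs.fderiv_right (by
    show (1 : WithTop ℕ∞) + 1 ≤ _
    exact WithTop.coe_le_coe.2 (le_top : ((1 + 1 : ℕ∞)) ≤ ⊤))
  have hd : Differentiable ℝ A := hs.differentiable (by simp)
  obtain ⟨C0, hC0⟩ := hc.exists_bound_of_continuous hs.continuous
  obtain ⟨C1, hC1⟩ := (hc.fderiv ℝ).exists_bound_of_continuous h1.continuous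
  obtain ⟨C2, hC2⟩ := ContDiff.lipschitzWith_of_hasCompactSupport (hc.fderiv ℝ) h1 (by norm_num)
  have hC0' : 0 ≤ C0 := (norm_nonneg _).trans (hC0 0)
  have hC1' : 0 ≤ C1 := (norm_nonneg _).trans (hC1 0)
  have hC2' : (0 : ℝ) ≤ C2 := C2.2
  have hL : ∀ x y, ‖fderiv ℝ A x - fderiv ℝ A y‖ ≤ C2 * ‖x - y‖ := fun x y => hC2.norm_sub_le x y
  have hap : ∀ (T : Phase n →L[ℝ] ℝ) (e : Phase n), ‖e‖ ≤ 1 → |T e| ≤ ‖T‖ := by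
    intro T e he
    have := T.le_opNorm e
    rw [Real.norm_eq_abs] at this
    nlinarith [norm_nonneg T]
  refine ⟨C0 + C1 + C2, hs, by positivity, ?_, ?_, ?_, ?_, ?_, ?_, ?_⟩
  · intro x
    have := hC0 x
    rw [Real.norm_eq_abs] at this
    linarith
  · intro x y
    have := Convex.norm_image_sub_le_of_norm_fderiv_le (s := Set.univ) (f := A) (𝕜 := ℝ)
      (fun z _ => hd z) (fun z _ => hC1 z) convex_univ (Set.mem_univ y) (Set.mem_univ x)
    rw [Real.norm_eq_abs] at this
    nlinarith [norm_nonneg (x - y)]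
  · intro i x
    have := (hap (fderiv ℝ A x) _ (norm_eP i)).trans (hC1 x)
    unfold pderivP
    linarith
  · intro i x
    have := (hap (fderiv ℝ A x) _ (norm_eQ i)).trans (hC1 x)
    unfold pderivQ
    linarith
  · intro i x y
    have := (hap (fderiv ℝ A x - fderiv ℝ A y) _ (norm_eP i)).trans (hL x y)
    rw [sub_apply] at this
    unfold pderivP
    nlinarith [norm_nonneg (x - y)]
  · intro i x y
    have := (hap (fderiv ℝ A x - fderiv ℝ A y) _ (norm_eQ i)).trans (hL x y)
    rw [sub_apply] at this
    unfold pderivQ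
    nlinarith [norm_nonneg (x - y)]
  · intro x w
    have := Convex.norm_image_sub_le_of_norm_fderiv_le' (s := Metric.closedBall x ‖w‖) (f := A)
      (𝕜 := ℝ) (φ := fderiv ℝ A x) (C := C2 * ‖w‖) (x := x) (y := x + w)
      (fun z _ => hd z) (fun z hz => (hL z x).trans (by
        rw [mem_closedBall_iff_norm] at hz; gcongr)) (convex_closedBall _ _)
      (by simp) (by simp)
    rw [Real.norm_eq_abs, add_sub_cancel_left, fderiv_eq_lin] at this
    nlinarith [sq_nonneg ‖w‖]

lemma Bd.mono {n : ℕ} {C C' : ℝ} {A : Phase n → ℝ} (h : Bd C A) (hC : C ≤ C') : Bd C' A := by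
  refine ⟨h.smooth, h.nonneg.trans hC, fun x => (h.bd x).trans hC, fun x y => (h.lip x y).trans ?_,
    fun i x => (h.dp i x).trans hC, fun i x => (h.dq i x).trans hC,
    fun i x y => (h.lp i x y).trans ?_, fun i x y => (h.lq i x y).trans ?_,
    fun x w => (h.tay x w).trans ?_⟩
  all_goals gcongr

lemma Bd.diff {n : ℕ} {C : ℝ} {A : Phase n → ℝ} (h : Bd C A) : Differentiable ℝ A :=
  h.smooth.differentiable (by simp)

lemma pderivP_add_smul {n : ℕ} {A B : Phase n → ℝ} (hA : Differentiable ℝ A)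
    (hB : Differentiable ℝ B) (τ : ℝ) (i : Fin n) (x : Phase n) :
    pderivP (fun x => A x + τ * B x) i x = pderivP A i x + τ * pderivP B i x := by
  unfold pderivP
  have := ((hA x).hasFDerivAt.add ((hB x).hasFDerivAt.const_mul τ)).fderiv
  have h2 : fderiv ℝ (fun x => A x + τ * B x) x = fderiv ℝ A x + τ • fderiv ℝ B x := this
  rw [h2]; simp

lemma pderivQ_add_smul {n : ℕ} {A B : Phase n → ℝ} (hA : Differentiable ℝ A)
    (hB : Differentiable ℝ B) (τ : ℝ) (i : Fin n) (x : Phase n) :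
    pderivQ (fun x => A x + τ * B x) i x = pderivQ A i x + τ * pderivQ B i x := by
  unfold pderivQ
  have := ((hA x).hasFDerivAt.add ((hB x).hasFDerivAt.const_mul τ)).fderiv
  have h2 : fderiv ℝ (fun x => A x + τ * B x) x = fderiv ℝ A x + τ • fderiv ℝ B x := this
  rw [h2]; simp

lemma pderivP_mul {n : ℕ} {B : Phase n → ℝ}
    (hB : Differentiable ℝ B) (τ : ℝ) (i : Fin n) (x : Phase n) :
    pderivP (fun x => τ * B x) i x = τ * pderivP B i x := by
  unfold pderivP
  rw [((hB x).hasFDerivAt.const_mul τ).fderiv]; simp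

lemma pderivQ_mul {n : ℕ} {B : Phase n → ℝ}
    (hB : Differentiable ℝ B) (τ : ℝ) (i : Fin n) (x : Phase n) :
    pderivQ (fun x => τ * B x) i x = τ * pderivQ B i x := by
  unfold pderivQ
  rw [((hB x).hasFDerivAt.const_mul τ).fderiv]; simp

lemma abs_add_mul_le {a b τ c c' : ℝ} (hτ : |τ| ≤ 1) (ha : |a| ≤ c) (hb : |b| ≤ c') :
    |a + τ * b| ≤ c + c' := by
  refine (abs_add_le _ _).trans (add_le_add ha ?_)
  rw [abs_mul]
  nlinarith [abs_nonneg b, abs_nonneg τ]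

lemma Bd.add_smul {n : ℕ} {C C' : ℝ} {A B : Phase n → ℝ} (hA : Bd C A) (hB : Bd C' B) {τ : ℝ}
    (hτ : |τ| ≤ 1) : Bd (C + C') (fun x => A x + τ * B x) := by
  refine ⟨hA.smooth.add (contDiff_const.mul hB.smooth), add_nonneg hA.nonneg hB.nonneg, ?_, ?_,
    ?_, ?_, ?_, ?_, ?_⟩
  · intro x; exact abs_add_mul_le hτ (hA.bd x) (hB.bd x)
  · intro x y
    rw [add_mul]
    convert abs_add_mul_le hτ (hA.lip x y) (hB.lip x y) using 2; ring
  · intro i x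
    rw [pderivP_add_smul hA.diff hB.diff]; exact abs_add_mul_le hτ (hA.dp i x) (hB.dp i x)
  · intro i x
    rw [pderivQ_add_smul hA.diff hB.diff]; exact abs_add_mul_le hτ (hA.dq i x) (hB.dq i x)
  · intro i x y
    rw [pderivP_add_smul hA.diff hB.diff, pderivP_add_smul hA.diff hB.diff, add_mul]
    convert abs_add_mul_le hτ (hA.lp i x y) (hB.lp i x y) using 2; ring
  · intro i x y
    rw [pderivQ_add_smul hA.diff hB.diff, pderivQ_add_smul hA.diff hB.diff, add_mul]
    convert abs_add_mul_le hτ (hA.lq i x y) (hB.lq i x y) using 2; ring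
  · intro x w
    have hl : lin (fun x => A x + τ * B x) x w = lin A x w + τ * lin B x w := by
      unfold lin
      rw [Finset.mul_sum, ← Finset.sum_add_distrib]
      refine Finset.sum_congr rfl fun i _ => ?_
      rw [pderivP_add_smul hA.diff hB.diff, pderivQ_add_smul hA.diff hB.diff]; ring
    rw [hl, add_mul]
    convert abs_add_mul_le hτ (hA.tay x w) (hB.tay x w) using 2; ring

lemma Bd.zero {n : ℕ} : Bd 0 (fun _ : Phase n => (0 : ℝ)) := by
  refine ⟨contDiff_const, le_rfl, ?_, ?_, ?_, ?_, ?_, ?_, ?_⟩ <;>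
    intros <;> simp [pderivP, pderivQ, lin]

lemma Bd.smul {n : ℕ} {C : ℝ} {B : Phase n → ℝ} (hB : Bd C B) {τ : ℝ}
    (hτ : |τ| ≤ 1) : Bd C (fun x => τ * B x) := by
  have := Bd.zero.add_smul hB hτ
  simpa using this

lemma Bd.contDiff_pderivP {n : ℕ} {C : ℝ} {A : Phase n → ℝ} (h : Bd C A) (i : Fin n) :
    ContDiff ℝ 1 (pderivP A i) := by
  have h1 : ContDiff ℝ 1 (fderiv ℝ A) := h.smooth.fderiv_right (by
    show (1 : WithTop ℕ∞) + 1 ≤ _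
    exact WithTop.coe_le_coe.2 (le_top : ((1 + 1 : ℕ∞)) ≤ ⊤))
  exact h1.clm_apply contDiff_const

lemma Bd.contDiff_pderivQ {n : ℕ} {C : ℝ} {A : Phase n → ℝ} (h : Bd C A) (i : Fin n) :
    ContDiff ℝ 1 (pderivQ A i) := by
  have h1 : ContDiff ℝ 1 (fderiv ℝ A) := h.smooth.fderiv_right (by
    show (1 : WithTop ℕ∞) + 1 ≤ _
    exact WithTop.coe_le_coe.2 (le_top : ((1 + 1 : ℕ∞)) ≤ ⊤))
  exact h1.clm_apply contDiff_const

end CV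

namespace CV
set_option linter.unusedSectionVars false

/-- Discrete loops. -/
abbrev Lp (n N : ℕ) := ZMod N → Phase n

/-- Parameter space of the negative subspace. -/
abbrev Wp (n N : ℕ) := (Fin n → ℝ) × (ZMod N → Fin n → ℝ)

variable {n N : ℕ} [NeZero N]

/-- The discrete symplectic area. -/
noncomputable def Qf (x : Lp n N) : ℝ :=
  ∑ j, ∑ i, (x j).1 i * ((x (j + 1)).2 i - (x j).2 i)

/-- The discrete action functional. -/
noncomputable def Act (H : ZMod N → Phase n → ℝ) (x : Lp n N) : ℝ :=
  Qf x - ∑ j, H j (x j)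

/-- Partial derivatives of the action. -/
noncomputable def gP (H : ZMod N → Phase n → ℝ) (x : Lp n N) (j : ZMod N) (i : Fin n) : ℝ :=
  (x (j + 1)).2 i - (x j).2 i - pderivP (H j) i (x j)

noncomputable def gQ (H : ZMod N → Phase n → ℝ) (x : Lp n N) (j : ZMod N) (i : Fin n) : ℝ :=
  (x (j - 1)).1 i - (x j).1 i - pderivQ (H j) i (x j)

lemma comp_le_norm (x : Phase n) (i : Fin n) : |x.1 i| ≤ ‖x‖ ∧ |x.2 i| ≤ ‖x‖ :=
  ⟨(norm_le_pi_norm x.1 i).trans (norm_fst_le x), (norm_le_pi_norm x.2 i).trans (norm_snd_le x)⟩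

lemma Qf_le (w : Lp n N) {t : ℝ} (hw : ∀ j, ‖w j‖ ≤ t) :
    Qf w ≤ N * (n * (2 * t ^ 2)) := by
  unfold Qf
  have : ∀ j ∈ (Finset.univ : Finset (ZMod N)), ∑ i, (w j).1 i * ((w (j + 1)).2 i - (w j).2 i)
      ≤ n * (2 * t ^ 2) := by
    intro j _
    have h2 : ∀ i ∈ (Finset.univ : Finset (Fin n)),
        (w j).1 i * ((w (j + 1)).2 i - (w j).2 i) ≤ 2 * t ^ 2 := by
      intro i _
      have a1 := ((comp_le_norm (w j) i).1).trans (hw j)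
      have a2 := ((comp_le_norm (w j) i).2).trans (hw j)
      have a3 := ((comp_le_norm (w (j + 1)) i).2).trans (hw (j + 1))
      have h3 : |(w (j + 1)).2 i - (w j).2 i| ≤ 2 * t := by
        refine (abs_sub _ _).trans (by linarith)
      refine (le_abs_self _).trans ?_
      rw [abs_mul]
      have h0 := abs_nonneg ((w j).1 i)
      nlinarith [abs_nonneg ((w (j + 1)).2 i - (w j).2 i)]
    simpa using Finset.sum_le_sum h2
  simpa [ZMod.card] using Finset.sum_le_sum this

lemma Qf_add (x w : Lp n N) : Qf (x + w) = Qf x + Qf w +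
    ∑ j, ∑ i, ((w j).1 i * ((x (j + 1)).2 i - (x j).2 i)
      + (w j).2 i * ((x (j - 1)).1 i - (x j).1 i)) := by
  have hshift : ∑ j : ZMod N, ∑ i, (w j).2 i * (x (j - 1)).1 i
      = ∑ j : ZMod N, ∑ i, (w (j + 1)).2 i * (x j).1 i := by
    rw [← Equiv.sum_comp (Equiv.addRight (1 : ZMod N))]
    simp
  have e1 : ∑ j, ∑ i, ((w j).1 i * ((x (j + 1)).2 i - (x j).2 i)
      + (w j).2 i * ((x (j - 1)).1 i - (x j).1 i))
      = ∑ j, ∑ i, ((w j).1 i * ((x (j + 1)).2 i - (x j).2 i) - (w j).2 i * (x j).1 i)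
        + ∑ j : ZMod N, ∑ i, (w j).2 i * (x (j - 1)).1 i := by
    simp only [← Finset.sum_add_distrib]
    refine Finset.sum_congr rfl fun j _ => Finset.sum_congr rfl fun i _ => ?_
    ring
  rw [e1, hshift]
  unfold Qf
  simp only [← Finset.sum_add_distrib]
  refine Finset.sum_congr rfl fun j _ => Finset.sum_congr rfl fun i _ => ?_
  simp only [Pi.add_apply, Prod.fst_add, Prod.snd_add]
  ring

lemma Act_taylor {H : ZMod N → Phase n → ℝ} {C : ℝ} (hH : ∀ j, Bd C (H j)) (x w : Lp n N)
    {t : ℝ} (hw : ∀ j, ‖w j‖ ≤ t) :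
    Act H (x + w) ≤ Act H x + ∑ j, ∑ i, ((w j).1 i * gP H x j i + (w j).2 i * gQ H x j i)
      + (N * (n * 2) + N * C) * t ^ 2 := by
  have h1 : ∀ j ∈ (Finset.univ : Finset (ZMod N)), H j (x j) + lin (H j) (x j) (w j) - C * t ^ 2
      ≤ H j ((x + w) j) := by
    intro j _
    have := (abs_le.1 ((hH j).tay (x j) (w j))).1
    have h2 : ‖w j‖ ^ 2 ≤ t ^ 2 := pow_le_pow_left₀ (norm_nonneg _) (hw j) 2
    have h3 := mul_le_mul_of_nonneg_left h2 (hH j).nonneg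
    rw [Pi.add_apply]
    linarith
  have h2 := Finset.sum_le_sum h1
  rw [Finset.sum_sub_distrib, Finset.sum_add_distrib] at h2
  simp only [Finset.sum_const, Finset.card_univ, ZMod.card, nsmul_eq_mul] at h2
  have h3 := Qf_le w hw
  have h4 : ∑ j, ∑ i, ((w j).1 i * gP H x j i + (w j).2 i * gQ H x j i)
      = ∑ j, ∑ i, ((w j).1 i * ((x (j + 1)).2 i - (x j).2 i)
      + (w j).2 i * ((x (j - 1)).1 i - (x j).1 i)) - ∑ j, lin (H j) (x j) (w j) := by
    unfold lin
    simp only [← Finset.sum_sub_distrib]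
    refine Finset.sum_congr rfl fun j _ => Finset.sum_congr rfl fun i _ => ?_
    unfold gP gQ
    ring
  unfold Act
  rw [Qf_add, h4]
  linarith

/-- Smooth truncation. -/
noncomputable def sg (y : ℝ) : ℝ := y / (1 + y ^ 2)

lemma abs_sg_le (y : ℝ) : |sg y| ≤ 1 := by
  unfold sg
  rw [abs_div, abs_of_pos (by positivity : 0 < 1 + y ^ 2), div_le_one (by positivity)]
  nlinarith [sq_abs y, sq_nonneg (|y| - 1)]

lemma sg_mul_nonneg (y : ℝ) : 0 ≤ sg y * y := by
  unfold sg
  rw [div_mul_eq_mul_div, ← sq]; positivity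

lemma sg_mul_ge {y ε : ℝ} (hε : 0 < ε) (hε1 : ε ≤ 1) (hy : ε ≤ |y|) : ε ^ 2 / 2 ≤ sg y * y := by
  unfold sg
  have h1 : ε ^ 2 ≤ y ^ 2 := by rw [← sq_abs y]; gcongr
  rw [div_mul_eq_mul_div, ← sq, div_le_div_iff₀ (by norm_num) (by positivity)]
  have h2 : ε ^ 2 ≤ 1 := pow_le_one₀ hε.le hε1
  nlinarith [sq_nonneg y]

lemma contDiff_sg : ContDiff ℝ 1 sg := by
  unfold sg
  exact contDiff_id.div (contDiff_const.add (contDiff_id.pow 2)) (fun y => by positivity)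

/-- Truncated gradient of the action. -/
noncomputable def vf (H : ZMod N → Phase n → ℝ) (x : Lp n N) : Lp n N :=
  fun j => (fun i => sg (gP H x j i), fun i => sg (gQ H x j i))

lemma norm_vf_le (H : ZMod N → Phase n → ℝ) (x : Lp n N) (j : ZMod N) : ‖vf H x j‖ ≤ 1 := by
  unfold vf
  rw [Prod.norm_def]
  refine max_le ?_ ?_ <;> refine (pi_norm_le_iff_of_nonneg zero_le_one).2 fun i => abs_sg_le _

lemma contDiff_vf {H : ZMod N → Phase n → ℝ} {C : ℝ} (hH : ∀ j, Bd C (H j)) :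
    ContDiff ℝ 1 (vf H) := by
  have hj : ∀ j : ZMod N, ContDiff ℝ 1 (fun x : Lp n N => x j) := fun j => contDiff_apply _ _ j
  have h1 : ∀ (j : ZMod N) (i : Fin n), ContDiff ℝ 1 (fun x : Lp n N => (x j).1 i) := fun j i =>
    (contDiff_apply ℝ ℝ i).comp (contDiff_fst.comp (hj j))
  have h2 : ∀ (j : ZMod N) (i : Fin n), ContDiff ℝ 1 (fun x : Lp n N => (x j).2 i) := fun j i =>
    (contDiff_apply ℝ ℝ i).comp (contDiff_snd.comp (hj j))
  refine contDiff_pi.2 fun j => ?_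
  refine ContDiff.prodMk (contDiff_pi.2 fun i => contDiff_sg.comp ?_)
    (contDiff_pi.2 fun i => contDiff_sg.comp ?_)
  · exact ((h2 _ i).sub (h2 j i)).sub (((hH j).contDiff_pderivP i).comp (hj j))
  · exact ((h1 _ i).sub (h1 j i)).sub (((hH j).contDiff_pderivQ i).comp (hj j))

/-- `x` is an `ε`-approximate discrete orbit. -/
def NearCrit (H : ZMod N → Phase n → ℝ) (ε : ℝ) (x : Lp n N) : Prop :=
  ∀ j i, |gP H x j i| < ε ∧ |gQ H x j i| < ε

lemma descent {H : ZMod N → Phase n → ℝ} {C : ℝ} (hH : ∀ j, Bd C (H j)) (x : Lp n N)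
    {t : ℝ} (ht : 0 ≤ t) {ε : ℝ} (hε : 0 < ε) (hε1 : ε ≤ 1) :
    Act H (x - t • vf H x) ≤ Act H x + (N * (n * 2) + N * C) * t ^ 2 ∧
    (¬ NearCrit H ε x →
      Act H (x - t • vf H x) ≤ Act H x - t * (ε ^ 2 / 2) + (N * (n * 2) + N * C) * t ^ 2) := by
  have h1 := Act_taylor hH x (- (t • vf H x)) (t := t) (fun j => by
    rw [Pi.neg_apply, norm_neg, Pi.smul_apply, norm_smul, Real.norm_of_nonneg ht]
    exact mul_le_of_le_one_right ht (norm_vf_le H x j))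
  rw [← sub_eq_add_neg] at h1
  have h2 : ∑ j, ∑ i, (((- (t • vf H x)) j).1 i * gP H x j i +
        ((- (t • vf H x)) j).2 i * gQ H x j i) =
      - (t * ∑ j, ∑ i, (sg (gP H x j i) * gP H x j i + sg (gQ H x j i) * gQ H x j i)) := by
    rw [Finset.mul_sum, ← Finset.sum_neg_distrib]
    refine Finset.sum_congr rfl fun j _ => ?_
    rw [Finset.mul_sum, ← Finset.sum_neg_distrib]
    refine Finset.sum_congr rfl fun i _ => ?_
    simp only [vf, Pi.neg_apply, Pi.smul_apply, Prod.fst_neg, Prod.snd_neg, Prod.smul_fst,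
      Prod.smul_snd, smul_eq_mul]
    ring
  have hnn : ∀ j i, 0 ≤ sg (gP H x j i) * gP H x j i + sg (gQ H x j i) * gQ H x j i :=
    fun j i => add_nonneg (sg_mul_nonneg _) (sg_mul_nonneg _)
  have hnn2 : ∀ j, 0 ≤ ∑ i, (sg (gP H x j i) * gP H x j i + sg (gQ H x j i) * gQ H x j i) :=
    fun j => Finset.sum_nonneg fun i _ => hnn j i
  rw [h2] at h1
  refine ⟨?_, ?_⟩
  · have := mul_nonneg ht (Finset.sum_nonneg fun j (_ : j ∈ Finset.univ) => hnn2 j)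
    linarith
  · intro hn
    unfold NearCrit at hn
    push Not at hn
    obtain ⟨j, i, hji⟩ := hn
    have h3 : ε ^ 2 / 2 ≤ sg (gP H x j i) * gP H x j i + sg (gQ H x j i) * gQ H x j i := by
      by_cases hp : |gP H x j i| < ε
      · linarith [sg_mul_ge hε hε1 (hji hp), sg_mul_nonneg (gP H x j i)]
      · linarith [sg_mul_ge hε hε1 (not_lt.1 hp), sg_mul_nonneg (gQ H x j i)]
    have h4 := Finset.single_le_sum (fun i (_ : i ∈ Finset.univ) => hnn j i) (Finset.mem_univ i)
    have h5 := Finset.single_le_sum (fun j (_ : j ∈ Finset.univ) => hnn2 j) (Finset.mem_univ j)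
    have := mul_le_mul_of_nonneg_left (h3.trans (h4.trans h5)) ht
    linarith

/-- The embedding of the negative subspace. -/
noncomputable def iot (w : Wp n N) : Lp n N :=
  fun j => (fun i => w.1 i - N * (w.2 (j + 1) i - w.2 j i), w.2 j)

/-- The sublevel set `{Act H ≤ c}` contains a deformation of the negative subspace. -/
def Reach (H : ZMod N → Phase n → ℝ) (c : ℝ) : Prop :=
  ∃ f : Wp n N → Lp n N, ContDiff ℝ 1 f ∧ (∃ C, ∀ w, ‖f w - iot w‖ ≤ C) ∧ ∀ w, Act H (f w) ≤ c

lemma Reach.mono {H : ZMod N → Phase n → ℝ} {c c' : ℝ} (h : Reach H c) (hc : c ≤ c') :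
    Reach H c' := by
  obtain ⟨f, h1, h2, h3⟩ := h
  exact ⟨f, h1, h2, fun w => (h3 w).trans hc⟩

lemma Reach.compare {H H' : ZMod N → Phase n → ℝ} {c d : ℝ} (h : Reach H c)
    (hd : ∀ x : Lp n N, ∑ j, H j (x j) ≤ ∑ j, H' j (x j) + d) : Reach H' (c + d) := by
  obtain ⟨f, h1, h2, h3⟩ := h
  refine ⟨f, h1, h2, fun w => ?_⟩
  have a := h3 w
  have b := hd (f w)
  unfold Act at *
  linarith

lemma Reach_zero : Reach (fun (_ : ZMod N) (_ : Phase n) => (0 : ℝ)) 0 := by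
  refine ⟨iot, ?_, ⟨0, by simp⟩, ?_⟩
  · refine contDiff_pi.2 fun j => ?_
    have hj : ∀ j : ZMod N, ContDiff ℝ 1 (fun w : Wp n N => w.2 j) := fun j =>
      (contDiff_apply _ _ j).comp contDiff_snd
    have hji : ∀ (j : ZMod N) (i : Fin n), ContDiff ℝ 1 (fun w : Wp n N => w.2 j i) := fun j i =>
      (contDiff_apply ℝ ℝ i).comp (hj j)
    refine ContDiff.prodMk (contDiff_pi.2 fun i => ?_) (hj j)
    exact ((contDiff_apply ℝ ℝ i).comp contDiff_fst).sub
      (contDiff_const.mul ((hji _ i).sub (hji j i)))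
  · intro w
    have h0 : ∑ j : ZMod N, ∑ i, w.1 i * (w.2 (j + 1) i - w.2 j i) = 0 := by
      have := Equiv.sum_comp (Equiv.addRight (1 : ZMod N)) (fun j => ∑ i, w.1 i * w.2 j i)
      simp only [Equiv.coe_addRight] at this
      simp only [mul_sub, Finset.sum_sub_distrib]
      linarith
    have h1 : Qf (iot w) = ∑ j : ZMod N, ∑ i, w.1 i * (w.2 (j + 1) i - w.2 j i)
        - N * ∑ j : ZMod N, ∑ i, (w.2 (j + 1) i - w.2 j i) ^ 2 := by
      unfold Qf iot
      simp only [Finset.mul_sum, ← Finset.sum_sub_distrib]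
      refine Finset.sum_congr rfl fun j _ => Finset.sum_congr rfl fun i _ => ?_
      ring
    unfold Act
    rw [h1, h0]
    have : 0 ≤ (N : ℝ) * ∑ j : ZMod N, ∑ i, (w.2 (j + 1) i - w.2 j i) ^ 2 := by positivity
    simp only [Finset.sum_const_zero]
    linarith

/-- Moving along a linear path of Hamiltonians costs only what is seen at near-orbits. -/
lemma Reach.path {H₀ H₁ : ZMod N → Phase n → ℝ} {C : ℝ} (h₀ : ∀ j, Bd C (H₀ j))
    (h₁ : ∀ j, Bd C (H₁ j)) {ε η : ℝ} (hε : 0 < ε) (hε1 : ε ≤ 1) (hη : 0 < η)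
    (hcrit : ∀ τ ∈ Set.Icc (0 : ℝ) 1, ∀ x : Lp n N,
      NearCrit (fun j x => H₀ j x + τ * H₁ j x) ε x → - ∑ j, H₁ j (x j) ≤ η)
    {c : ℝ} (hr : Reach H₀ c) : Reach (fun j x => H₀ j x + H₁ j x) (c + 2 * η) := by
  have hC : 0 ≤ C := (h₀ 0).nonneg
  set B : ℝ := N * C with hB
  have hB0 : 0 ≤ B := by positivity
  set L : ℝ := N * (n * 2) + N * (C + C) with hL
  have hL0 : 0 ≤ L := by positivity
  set M : ℝ := 2 * B / ε ^ 2 with hM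
  have hM0 : 0 ≤ M := by positivity
  set D : ℝ := L * M ^ 2 + B * M with hD
  have hD0 : 0 ≤ D := by positivity
  have hPb : ∀ x : Lp n N, |∑ j, H₁ j (x j)| ≤ B := by
    intro x
    refine (Finset.abs_sum_le_sum_abs _ _).trans ?_
    have := Finset.sum_le_sum fun j (_ : j ∈ (Finset.univ : Finset (ZMod N))) => (h₁ j).bd (x j)
    simpa [ZMod.card] using this
  have step : ∀ τ h : ℝ, 0 ≤ τ → τ ≤ 1 → 0 ≤ h → ∀ c,
      Reach (fun j x => H₀ j x + τ * H₁ j x) c →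
      Reach (fun j x => H₀ j x + (τ + h) * H₁ j x) (c + h * η + D * h ^ 2) := by
    intro τ h hτ0 hτ1 hh c ⟨f, hf1, ⟨Cf, hf2⟩, hf3⟩
    have hbd : ∀ j, Bd (C + C) (fun x => H₀ j x + τ * H₁ j x) := fun j =>
      (h₀ j).add_smul (h₁ j) (by rw [abs_of_nonneg hτ0]; exact hτ1)
    set H : ZMod N → Phase n → ℝ := fun j x => H₀ j x + τ * H₁ j x with hH
    set t := M * h with ht
    have ht0 : 0 ≤ t := by positivity
    refine ⟨fun w => f w - t • vf H (f w), ?_, ⟨Cf + t, fun w => ?_⟩, fun w => ?_⟩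
    · exact hf1.sub (((contDiff_vf hbd).comp hf1).const_smul t)
    · have e : f w - t • vf H (f w) - iot w = (f w - iot w) - t • vf H (f w) := by abel
      rw [e]
      refine (norm_sub_le _ _).trans (add_le_add (hf2 w) ?_)
      rw [norm_smul, Real.norm_of_nonneg ht0]
      refine mul_le_of_le_one_right ht0 ?_
      exact (pi_norm_le_iff_of_nonneg zero_le_one).2 fun j => norm_vf_le _ _ j
    · set x := f w with hx
      set y := x - t • vf H x with hy
      have hact : Act (fun j x => H₀ j x + (τ + h) * H₁ j x) y = Act H y - h * ∑ j, H₁ j (y j) := by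
        unfold Act
        rw [hH, Finset.mul_sum, sub_sub, ← Finset.sum_add_distrib]
        congr 1
        refine Finset.sum_congr rfl fun j _ => ?_
        ring
      rw [hact]
      obtain ⟨d1, d2⟩ := descent hbd x ht0 hε hε1
      have hfx := hf3 w
      have hBM : 0 ≤ B * M * h ^ 2 := by positivity
      by_cases hn : NearCrit H ε x
      · have hψ := hcrit τ ⟨hτ0, hτ1⟩ x hn
        have hlip : |∑ j, H₁ j (y j) - ∑ j, H₁ j (x j)| ≤ B * t := by
          rw [← Finset.sum_sub_distrib]
          refine (Finset.abs_sum_le_sum_abs _ _).trans ?_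
          have : ∀ j ∈ (Finset.univ : Finset (ZMod N)), |H₁ j (y j) - H₁ j (x j)| ≤ C * t := by
            intro j _
            refine ((h₁ j).lip _ _).trans ?_
            refine mul_le_mul_of_nonneg_left ?_ hC
            have e : y j - x j = - (t • vf H x j) := by simp [hy]
            rw [e, norm_neg, norm_smul, Real.norm_of_nonneg ht0]
            exact mul_le_of_le_one_right ht0 (norm_vf_le _ _ j)
          have := Finset.sum_le_sum this
          simpa [ZMod.card, hB, mul_assoc] using this
        have h3 := (abs_le.1 hlip).1
        have h4 : - ∑ j, H₁ j (y j) ≤ η + B * t := by linarith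
        have h5 := mul_le_mul_of_nonneg_left h4 hh
        rw [hD]
        have e2 : (L * M ^ 2 + B * M) * h ^ 2 = L * t ^ 2 + h * (B * t) := by rw [ht]; ring
        rw [e2]
        linarith
      · have d3 := d2 hn
        have h3 := (abs_le.1 (hPb y)).1
        have h5 := mul_le_mul_of_nonneg_left h3 hh
        have e1 : t * (ε ^ 2 / 2) = h * B := by
          rw [ht, hM]; field_simp
        have e2 : D * h ^ 2 = L * t ^ 2 + B * M * h ^ 2 := by rw [hD, ht]; ring
        have : 0 ≤ h * η := by positivity
        rw [e2]
        linarith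
  obtain ⟨T, hT⟩ := exists_nat_gt (D / η)
  have hTpos : (0 : ℝ) < T := lt_of_le_of_lt (by positivity) hT
  have key : ∀ k : ℕ, k ≤ T → Reach (fun j x => H₀ j x + (k / T : ℝ) * H₁ j x)
      (c + k * (1 / T * η + D * (1 / T : ℝ) ^ 2)) := by
    intro k
    induction k with
    | zero => intro _; simpa using hr
    | succ k ih =>
      intro hk
      have hk' : (k : ℝ) ≤ T := by exact_mod_cast (Nat.le_of_succ_le hk)
      have := step (k / T) (1 / T) (by positivity) ((div_le_one hTpos).2 hk') (by positivity) _
        (ih (Nat.le_of_succ_le hk))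
      have e1 : ((k : ℝ) / T + 1 / T) = ((k + 1 : ℕ) : ℝ) / T := by push_cast; ring
      rw [e1] at this
      refine this.mono (le_of_eq ?_)
      push_cast
      ring
  have := key T le_rfl
  rw [div_self hTpos.ne'] at this
  simp only [one_mul] at this
  refine this.mono ?_
  have e : (T : ℝ) * (1 / T * η + D * (1 / T : ℝ) ^ 2) = η + D / T := by
    field_simp
  rw [e]
  have : D / T ≤ η := by
    rw [div_le_iff₀ hTpos]
    rw [div_lt_iff₀ hη] at hT
    linarith
  linarith

end CV

namespace CV
set_option linter.unusedSectionVars false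
variable {n N : ℕ} [NeZero N]

lemma zsum_shift (r : ZMod N → ℝ) : ∑ j, (r (j + 1) - r j) = 0 := by
  rw [Finset.sum_sub_distrib]
  have := Equiv.sum_comp (Equiv.addRight (1 : ZMod N)) r
  simp only [Equiv.coe_addRight] at this
  linarith

lemma zdiff_le (r : ZMod N → ℝ) (j k : ZMod N) : |r j - r k| ≤ ∑ l, |r (l + 1) - r l| := by
  have main : ∀ a b : ℕ, a ≤ b → b < N → |r (b : ZMod N) - r (a : ZMod N)| ≤ ∑ l, |r (l + 1) - r l| := by
    intro a b hab hb
    have h1 : r (b : ZMod N) - r (a : ZMod N)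
        = ∑ l ∈ Finset.Ico a b, (r ((l : ZMod N) + 1) - r (l : ZMod N)) := by
      have := Finset.sum_Ico_sub (fun l : ℕ => r (l : ZMod N)) hab
      rw [← this]
      refine Finset.sum_congr rfl fun l _ => ?_
      push_cast; rfl
    rw [h1]
    refine (Finset.abs_sum_le_sum_abs _ _).trans ?_
    have hinj : Set.InjOn (fun l : ℕ => (l : ZMod N)) (Finset.Ico a b) := by
      intro l hl l' hl' h
      have h2 := (Finset.mem_Ico.1 (Finset.mem_coe.1 hl)).2
      have h3 := (Finset.mem_Ico.1 (Finset.mem_coe.1 hl')).2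
      have := congrArg ZMod.val h
      simp only [] at this
      rwa [ZMod.val_natCast_of_lt (h2.trans hb), ZMod.val_natCast_of_lt (h3.trans hb)] at this
    rw [← Finset.sum_image (f := fun l : ZMod N => |r (l + 1) - r l|) hinj]
    exact Finset.sum_le_sum_of_subset_of_nonneg (Finset.subset_univ _) (fun _ _ _ => abs_nonneg _)
  have hj := ZMod.natCast_zmod_val j
  have hk := ZMod.natCast_zmod_val k
  rcases le_total j.val k.val with h | h
  · have := main _ _ h (ZMod.val_lt k)
    rw [hj, hk] at this
    rwa [abs_sub_comm]
  · have := main _ _ h (ZMod.val_lt j)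
    rwa [hj, hk] at this

lemma zmean_sq (r : ZMod N → ℝ) {q : ℝ} (hq : ∑ j, r j = N * q) (j : ZMod N) :
    (r j - q) ^ 2 ≤ N * ∑ l, (r (l + 1) - r l) ^ 2 := by
  have hN : (0 : ℝ) < N := by exact_mod_cast Nat.pos_of_ne_zero (NeZero.ne N)
  set T := ∑ l, |r (l + 1) - r l| with hT
  have h1 : N * (r j - q) = ∑ k, (r j - r k) := by
    rw [Finset.sum_sub_distrib, hq]; simp [ZMod.card, mul_sub]
  have h2 : |(N : ℝ) * (r j - q)| ≤ N * T := by
    rw [h1]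
    refine (Finset.abs_sum_le_sum_abs _ _).trans ?_
    have := Finset.sum_le_sum fun k (_ : k ∈ (Finset.univ : Finset (ZMod N))) => zdiff_le r j k
    simpa [ZMod.card] using this
  rw [abs_mul, abs_of_pos hN] at h2
  have h3 : |r j - q| ≤ T := le_of_mul_le_mul_left h2 hN
  have h4 : T ^ 2 ≤ N * ∑ l, (r (l + 1) - r l) ^ 2 := by
    have := sq_sum_le_card_mul_sum_sq (s := (Finset.univ : Finset (ZMod N)))
      (f := fun l => |r (l + 1) - r l|)
    simpa [ZMod.card, sq_abs] using this
  rw [← sq_abs]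
  exact (pow_le_pow_left₀ (abs_nonneg _) h3 2).trans h4

/-- Linear version of `iot`. -/
noncomputable def iotL : Wp n N →ₗ[ℝ] Lp n N where
  toFun := iot
  map_add' a b := by
    ext j i <;> simp [iot]; ring
  map_smul' c a := by
    ext j i <;> simp [iot]; ring

/-- The projection used for linking. -/
noncomputable def piL : Lp n N →ₗ[ℝ] Wp n N where
  toFun x := (fun i => (∑ k, (x k).1 i) / N, fun j i => (∑ k, (x k).2 i) / N +
    ((x j).1 i - (∑ k, (x k).1 i) / N - N * ((x (j + 1)).2 i - (x j).2 i)))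
  map_add' a b := by
    ext <;> simp [Finset.sum_add_distrib] <;> ring
  map_smul' c a := by
    ext <;> simp [← Finset.mul_sum] <;> ring

lemma sigma_inj : Function.Injective (piL.comp (iotL (n := n) (N := N))) := by
  have hN : (N : ℝ) ≠ 0 := by exact_mod_cast NeZero.ne N
  rw [← LinearMap.ker_eq_bot, LinearMap.ker_eq_bot']
  intro w hw
  have h1 : ∀ i, (∑ k, (iot w k).1 i) / N = 0 := fun i => congrFun (congrArg Prod.fst hw) i
  have h2 : ∀ j i, (∑ k, (iot w k).2 i) / N +
    ((iot w j).1 i - (∑ k, (iot w k).1 i) / N - N * ((iot w (j + 1)).2 i - (iot w j).2 i)) = 0 :=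
    fun j i => congrFun (congrFun (congrArg Prod.snd hw) j) i
  have h3 : ∀ i, w.1 i = 0 := by
    intro i
    have := h1 i
    simp only [iot] at this
    rw [Finset.sum_sub_distrib, ← Finset.mul_sum, zsum_shift (fun j => w.2 j i)] at this
    simpa [ZMod.card, hN] using this
  have h4 : ∀ j i, (∑ k, w.2 k i) / N = 2 * N * (w.2 (j + 1) i - w.2 j i) := by
    intro j i
    have := h2 j i
    rw [h1 i] at this
    simp only [iot, h3 i] at this
    linarith
  have h5 : ∀ i, (∑ k, w.2 k i) / N = 0 := by
    intro i
    have := Finset.sum_congr rfl fun j (_ : j ∈ (Finset.univ : Finset (ZMod N))) => h4 j i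
    rw [← Finset.mul_sum, zsum_shift (fun j => w.2 j i)] at this
    simpa [ZMod.card, hN] using this
  have h6 : ∀ j i, w.2 (j + 1) i = w.2 j i := by
    intro j i
    have := h4 j i
    rw [h5] at this
    have h7 : (2 * (N : ℝ)) ≠ 0 := by positivity
    have := (mul_eq_zero.1 this.symm).resolve_left h7
    linarith
  have h7 : ∀ (k : ℕ) i, w.2 (k : ZMod N) i = w.2 0 i := by
    intro k i
    induction k with
    | zero => simp
    | succ k ih => push_cast; rw [h6, ih]
  have h8 : ∀ j i, w.2 j i = w.2 0 i := by
    intro j i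
    have := h7 j.val i
    rwa [ZMod.natCast_zmod_val] at this
  have h9 : ∀ i, w.2 0 i = 0 := by
    intro i
    have := h5 i
    simp_rw [h8] at this
    simpa [ZMod.card, hN] using this
  ext j i
  · exact h3 j
  · rw [h8, h9]; rfl

lemma Reach.link {H : ZMod N → Phase n → ℝ} {c : ℝ} (h : Reach H c) (x₀ : Phase n) :
    ∃ x : Lp n N, Act H x ≤ c ∧ (∀ i, ∑ j, (x j).2 i = N * x₀.2 i) ∧
      ∀ j i, (x j).1 i = x₀.1 i + N * ((x (j + 1)).2 i - (x j).2 i) := by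
  have hN : (N : ℝ) ≠ 0 := by exact_mod_cast NeZero.ne N
  obtain ⟨f, hf1, ⟨C, hf2⟩, hf3⟩ := h
  let σ := LinearEquiv.ofInjectiveEndo (piL.comp (iotL (n := n) (N := N))) sigma_inj
  let T : Lp n N →L[ℝ] Wp n N := LinearMap.toContinuousLinearMap (σ.symm.toLinearMap.comp piL)
  have hT : ∀ x, T x = σ.symm (piL x) := fun x => rfl
  have hTi : ∀ w, T (iot w) = w := by
    intro w
    rw [hT, LinearEquiv.symm_apply_eq]
    rfl
  have hs : Function.Surjective (fun w => T (f w)) := by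
    refine surj_of_bounded (C := ‖T‖ * C) (T.contDiff.comp hf1) fun w => ?_
    nth_rewrite 2 [← hTi w]
    rw [← map_sub]
    exact (T.le_opNorm _).trans (mul_le_mul_of_nonneg_left (hf2 w) (norm_nonneg _))
  obtain ⟨w, hw⟩ := hs (σ.symm (x₀.1, fun _ => x₀.2))
  simp only [hT] at hw
  have hw' := σ.symm.injective hw
  refine ⟨f w, hf3 w, ?_⟩
  set x := f w
  have h1 : ∀ i, (∑ k, (x k).1 i) / N = x₀.1 i := fun i => congrFun (congrArg Prod.fst hw') i
  have h2 : ∀ j i, (∑ k, (x k).2 i) / N +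
    ((x j).1 i - (∑ k, (x k).1 i) / N - N * ((x (j + 1)).2 i - (x j).2 i)) = x₀.2 i :=
    fun j i => congrFun (congrFun (congrArg Prod.snd hw') j) i
  have h3 : ∀ i, (∑ k, (x k).2 i) / N = x₀.2 i := by
    intro i
    have := Finset.sum_congr rfl fun j (_ : j ∈ (Finset.univ : Finset (ZMod N))) => h2 j i
    rw [Finset.sum_add_distrib, Finset.sum_sub_distrib, Finset.sum_sub_distrib, ← Finset.mul_sum,
      zsum_shift (fun j => (x j).2 i)] at this
    simp only [Finset.sum_const, Finset.card_univ, ZMod.card, nsmul_eq_mul] at this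
    rw [mul_div_cancel₀ _ hN, mul_div_cancel₀ _ hN] at this
    rw [div_eq_iff hN]
    linarith
  refine ⟨fun i => ?_, fun j i => ?_⟩
  · have := h3 i
    rw [div_eq_iff hN] at this
    linarith
  · have := h2 j i
    rw [h3, h1] at this
    linarith

lemma Reach.lower {H : ZMod N → Phase n → ℝ} {c : ℝ} (h : Reach H c) {K : Phase n → ℝ}
    {x₀ : Phase n} {k₀ b : ℝ} (hb : 0 ≤ b) (hb4 : 4 * b ≤ 1)
    (hK : ∀ x, k₀ - b * ‖x - x₀‖ ^ 2 ≤ K x) {m : ℕ} (hm : 0 < m) (hNm : N = 3 * m)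
    {S : Finset (ZMod N)} (hS : S.card = m)
    (hH : ∀ x : Lp n N, ∑ j, H j (x j) = - (1 / (m : ℝ)) * ∑ j ∈ S, K (x j)) : k₀ ≤ c := by
  have hN : (0 : ℝ) < N := by exact_mod_cast Nat.pos_of_ne_zero (NeZero.ne N)
  have hmr : (0 : ℝ) < m := by exact_mod_cast hm
  have hNmr : (N : ℝ) = 3 * m := by rw [hNm]; push_cast; ring
  obtain ⟨x, hx, hxq, hxp⟩ := h.link x₀
  refine le_trans ?_ hx
  let u : ZMod N → Fin n → ℝ := fun j i => (x (j + 1)).2 i - (x j).2 i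
  set A : ℝ := N * ∑ j, ∑ i, u j i ^ 2 with hA
  have hA0 : 0 ≤ A := by positivity
  have hQ : Qf x = A := by
    have h0 : ∑ j : ZMod N, ∑ i, x₀.1 i * u j i = 0 := by
      rw [Finset.sum_comm]
      refine Finset.sum_eq_zero fun i _ => ?_
      rw [← Finset.mul_sum, zsum_shift (fun j => (x j).2 i), mul_zero]
    have : Qf x = ∑ j : ZMod N, ∑ i, x₀.1 i * u j i + A := by
      unfold Qf
      rw [hA]
      simp only [Finset.mul_sum, ← Finset.sum_add_distrib]
      refine Finset.sum_congr rfl fun j _ => Finset.sum_congr rfl fun i _ => ?_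
      rw [hxp]; simp only [u]; ring
    rw [this, h0, zero_add]
  have hnorm : ∀ j, ‖x j - x₀‖ ^ 2 ≤ N ^ 2 * ∑ i, u j i ^ 2 + A := by
    intro j
    have hR : 0 ≤ N ^ 2 * ∑ i, u j i ^ 2 + A := by positivity
    have hle : ‖x j - x₀‖ ≤ Real.sqrt (N ^ 2 * ∑ i, u j i ^ 2 + A) := by
      rw [Prod.norm_def]
      refine max_le ?_ ?_ <;> refine (pi_norm_le_iff_of_nonneg (Real.sqrt_nonneg _)).2 fun i => ?_
      · rw [Real.norm_eq_abs]
        apply Real.abs_le_sqrt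
        have e : (x j - x₀).1 i = N * u j i := by
          simp only [Prod.fst_sub, Pi.sub_apply, hxp, u]; ring
        rw [e, mul_pow]
        have := Finset.single_le_sum (fun i (_ : i ∈ Finset.univ) => sq_nonneg (u j i))
          (Finset.mem_univ i)
        have := mul_le_mul_of_nonneg_left this (sq_nonneg (N : ℝ))
        linarith
      · rw [Real.norm_eq_abs]
        apply Real.abs_le_sqrt
        have h1 := zmean_sq (fun j => (x j).2 i) (hxq i) j
        have h2 : N * ∑ l, u l i ^ 2 ≤ A := by
          rw [hA, Finset.sum_comm (f := fun j i => u j i ^ 2)]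
          refine mul_le_mul_of_nonneg_left ?_ hN.le
          exact Finset.single_le_sum (f := fun i => ∑ l, u l i ^ 2)
            (fun i (_ : i ∈ Finset.univ) => by positivity) (Finset.mem_univ i)
        have h3 : (0 : ℝ) ≤ N ^ 2 * ∑ i, u j i ^ 2 := by positivity
        have e : (x j - x₀).2 i = (x j).2 i - x₀.2 i := rfl
        rw [e]
        exact h1.trans (h2.trans (by linarith))
    calc ‖x j - x₀‖ ^ 2 ≤ _ := pow_le_pow_left₀ (norm_nonneg _) hle 2
      _ = _ := Real.sq_sqrt hR
  have hsum : ∑ j ∈ S, ‖x j - x₀‖ ^ 2 ≤ 4 * m * A := by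
    calc ∑ j ∈ S, ‖x j - x₀‖ ^ 2 ≤ ∑ j ∈ S, (N ^ 2 * ∑ i, u j i ^ 2 + A) :=
          Finset.sum_le_sum fun j _ => hnorm j
      _ = N ^ 2 * ∑ j ∈ S, ∑ i, u j i ^ 2 + m * A := by
          rw [Finset.sum_add_distrib, Finset.mul_sum]; simp [hS]
      _ ≤ N ^ 2 * ∑ j, ∑ i, u j i ^ 2 + m * A := by
          gcongr
          exact Finset.subset_univ S
      _ = 4 * m * A := by
          have : (N : ℝ) ^ 2 * ∑ j, ∑ i, u j i ^ 2 = N * A := by rw [hA]; ring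
          rw [this, hNmr]; ring
  have hKs : m * k₀ - b * (4 * m * A) ≤ ∑ j ∈ S, K (x j) := by
    have := Finset.sum_le_sum fun j (_ : j ∈ S) => hK (x j)
    rw [Finset.sum_sub_distrib, ← Finset.mul_sum] at this
    simp only [Finset.sum_const, hS, nsmul_eq_mul] at this
    have := mul_le_mul_of_nonneg_left hsum hb
    linarith
  unfold Act
  rw [hQ, hH]
  have h1 : k₀ - 4 * b * A ≤ 1 / (m : ℝ) * ∑ j ∈ S, K (x j) := by
    rw [one_div, le_inv_mul_iff₀ hmr]
    linarith
  nlinarith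
end CV

namespace CV
set_option linter.unusedSectionVars false
variable {n : ℕ}

/-- Approximate discrete Hamiltonian orbits. -/
def Orb (X : ℕ → Phase n) (A : Phase n → ℝ) (m lo hi : ℕ) : Prop :=
  ∀ k, lo ≤ k → k + 1 < hi → ∀ i,
    |(X (k + 1)).2 i - (X k).2 i - 1 / (m : ℝ) * pderivP A i (X k)| ≤ 1 / (m : ℝ) ^ 2 ∧
    |(X k).1 i - (X (k + 1)).1 i - 1 / (m : ℝ) * pderivQ A i (X (k + 1))| ≤ 1 / (m : ℝ) ^ 2

lemma norm_phase_le {x : Phase n} {c : ℝ} (hc : 0 ≤ c) (h : ∀ i, |x.1 i| ≤ c ∧ |x.2 i| ≤ c) :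
    ‖x‖ ≤ c := by
  rw [Prod.norm_def, max_le_iff]
  exact ⟨(pi_norm_le_iff_of_nonneg hc).2 fun i => (h i).1,
    (pi_norm_le_iff_of_nonneg hc).2 fun i => (h i).2⟩

lemma Orb.step {X : ℕ → Phase n} {A : Phase n → ℝ} {m lo hi : ℕ} {c : ℝ} (h : Orb X A m lo hi)
    (hA : Bd c A) {k : ℕ} (hk : lo ≤ k) (hk' : k + 1 < hi) :
    ‖X (k + 1) - X k‖ ≤ 1 / (m : ℝ) * c + 1 / (m : ℝ) ^ 2 := by
  have hc := hA.nonneg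
  refine norm_phase_le (by positivity) fun i => ?_
  obtain ⟨h1, h2⟩ := h k hk hk' i
  have a1 : |1 / (m : ℝ) * pderivP A i (X k)| ≤ 1 / (m : ℝ) * c := by
    rw [abs_mul, abs_of_nonneg (by positivity : (0 : ℝ) ≤ 1 / (m : ℝ))]
    exact mul_le_mul_of_nonneg_left (hA.dp i _) (by positivity)
  have a2 : |1 / (m : ℝ) * pderivQ A i (X (k + 1))| ≤ 1 / (m : ℝ) * c := by
    rw [abs_mul, abs_of_nonneg (by positivity : (0 : ℝ) ≤ 1 / (m : ℝ))]
    exact mul_le_mul_of_nonneg_left (hA.dq i _) (by positivity)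
  simp only [Prod.fst_sub, Prod.snd_sub, Pi.sub_apply]
  rw [abs_le] at *
  exact ⟨⟨by linarith, by linarith⟩, abs_le.2 ⟨by linarith, by linarith⟩⟩

lemma Orb.dist {X : ℕ → Phase n} {A : Phase n → ℝ} {m lo : ℕ} {c : ℝ}
    (h : Orb X A m lo (lo + m)) (hm : 0 < m) (hA : Bd c A) {k l : ℕ} (hk : lo ≤ k) (hkl : k ≤ l)
    (hl : l < lo + m) : ‖X l - X k‖ ≤ c + 1 / (m : ℝ) := by
  have key : ∀ d : ℕ, k + d < lo + m → ‖X (k + d) - X k‖ ≤ d * (1 / (m : ℝ) * c + 1 / (m : ℝ) ^ 2) := by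
    intro d
    induction d with
    | zero => intro _; simp
    | succ d ih =>
      intro hd
      have h1 := ih (by omega)
      have h2 := h.step hA (k := k + d) (by omega) (by omega)
      have h3 : X (k + (d + 1)) - X k = (X (k + d + 1) - X (k + d)) + (X (k + d) - X k) := by
        rw [← add_assoc]; abel
      rw [h3]
      refine (norm_add_le _ _).trans ?_
      push_cast
      linarith
  obtain ⟨d, rfl⟩ := Nat.exists_eq_add_of_le hkl
  refine (key d hl).trans ?_
  have hc := hA.nonneg
  have hm' : (0 : ℝ) < m := by exact_mod_cast hm
  have hd : (d : ℝ) ≤ m := by exact_mod_cast (by omega : d ≤ m)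
  calc (d : ℝ) * (1 / (m : ℝ) * c + 1 / (m : ℝ) ^ 2)
      ≤ m * (1 / (m : ℝ) * c + 1 / (m : ℝ) ^ 2) := by gcongr
    _ = c + 1 / (m : ℝ) := by field_simp

/-- The error constant. -/
noncomputable def Dc (n : ℕ) (C : ℝ) : ℝ := C * (C + 1) ^ 2 + n * (2 * C * (1 + C * (C + 1)))

lemma Orb.brk {X : ℕ → Phase n} {A B : Phase n → ℝ} {m lo hi : ℕ} {C : ℝ} (h : Orb X A m lo hi)
    (hm : 0 < m) (hA : Bd C A) (hB : Bd C B) {k : ℕ} (hk : lo ≤ k) (hk' : k + 1 < hi) :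
    |B (X (k + 1)) - B (X k) - 1 / (m : ℝ) * poisson B A (X k)| ≤ Dc n C * (1 / (m : ℝ)) ^ 2 := by
  have hC := hA.nonneg
  have hm1 : (1 : ℝ) ≤ m := by exact_mod_cast hm
  set u : ℝ := 1 / (m : ℝ) with hu
  have hu0 : 0 ≤ u := by positivity
  have hu1 : u ≤ 1 := by rw [hu, div_le_one (by linarith)]; exact hm1
  have hu2 : 1 / (m : ℝ) ^ 2 = u ^ 2 := by rw [hu]; ring
  have hs := h.step hA hk hk'
  rw [hu2, ← hu] at hs
  set w := X (k + 1) - X k with hw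
  have hwn : ‖w‖ ≤ u * (C + 1) := by nlinarith
  have hX : X (k + 1) = X k + w := by rw [hw]; abel
  have ht := hB.tay (X k) w
  rw [← hX] at ht
  have hl : |lin B (X k) w - u * poisson B A (X k)| ≤ n * (2 * C * (1 + C * (C + 1))) * u ^ 2 := by
    unfold lin poisson
    rw [Finset.mul_sum, ← Finset.sum_sub_distrib]
    refine (Finset.abs_sum_le_sum_abs _ _).trans ?_
    have : ∀ i ∈ (Finset.univ : Finset (Fin n)),
        |w.1 i * pderivP B i (X k) + w.2 i * pderivQ B i (X k) -
        u * (pderivQ B i (X k) * pderivP A i (X k) - pderivP B i (X k) * pderivQ A i (X k))|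
        ≤ 2 * C * (1 + C * (C + 1)) * u ^ 2 := by
      intro i _
      obtain ⟨h1, h2⟩ := h k hk hk' i
      rw [hu2, ← hu] at h1 h2
      have h3 := hA.lq i (X (k + 1)) (X k)
      rw [← hw] at h3
      have h3' : |u * (pderivQ A i (X (k + 1)) - pderivQ A i (X k))| ≤ C * (C + 1) * u ^ 2 := by
        rw [abs_mul, abs_of_nonneg hu0]
        calc u * |pderivQ A i (X (k + 1)) - pderivQ A i (X k)| ≤ u * (C * (u * (C + 1))) := by
              gcongr; exact h3.trans (by gcongr)
          _ = _ := by ring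
      set eq := (X (k + 1)).2 i - (X k).2 i - u * pderivP A i (X k)
      set ep := (X k).1 i - (X (k + 1)).1 i - u * pderivQ A i (X (k + 1))
      have e : w.1 i * pderivP B i (X k) + w.2 i * pderivQ B i (X k) -
        u * (pderivQ B i (X k) * pderivP A i (X k) - pderivP B i (X k) * pderivQ A i (X k))
        = -(ep + u * (pderivQ A i (X (k + 1)) - pderivQ A i (X k))) * pderivP B i (X k)
          + eq * pderivQ B i (X k) := by
        simp only [hw, ep, eq, Prod.fst_sub, Prod.snd_sub, Pi.sub_apply]; ring
      rw [e]
      refine (abs_add_le _ _).trans ?_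
      rw [abs_mul, abs_mul, abs_neg]
      have e1 : |ep + u * (pderivQ A i (X (k + 1)) - pderivQ A i (X k))| ≤ u ^ 2 + C * (C + 1) * u ^ 2 :=
        (abs_add_le _ _).trans (add_le_add h2 h3')
      have b1 := mul_le_mul e1 (hB.dp i (X k)) (abs_nonneg _) (by positivity)
      have b2 := mul_le_mul h1 (hB.dq i (X k)) (abs_nonneg _) (by positivity)
      have : 0 ≤ C * (C * (C + 1)) * u ^ 2 := by positivity
      nlinarith
    refine (Finset.sum_le_sum this).trans (le_of_eq ?_)
    simp; ring
  have ht' : C * ‖w‖ ^ 2 ≤ C * (C + 1) ^ 2 * u ^ 2 := by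
    calc C * ‖w‖ ^ 2 ≤ C * (u * (C + 1)) ^ 2 := by gcongr
      _ = _ := by ring
  unfold Dc
  rw [abs_le] at *
  constructor <;> nlinarith

lemma Dc_nonneg {C : ℝ} (hC : 0 ≤ C) : 0 ≤ Dc n C := by unfold Dc; positivity

lemma Orb.tele {X : ℕ → Phase n} {A B : Phase n → ℝ} {m lo : ℕ} {C : ℝ}
    (h : Orb X A m lo (lo + m))
    (hm : 0 < m) (hA : Bd C A) (hB : Bd C B) {k l : ℕ} (hk : lo ≤ k) (hkl : k ≤ l)
    (hl : l < lo + m) :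
    |B (X l) - B (X k) - 1 / (m : ℝ) * ∑ j ∈ Finset.Ico k l, poisson B A (X j)|
      ≤ Dc n C / m := by
  have hD : 0 ≤ Dc n C := Dc_nonneg hA.nonneg
  have key : ∀ d : ℕ, k + d < lo + m →
      |B (X (k + d)) - B (X k) - 1 / (m : ℝ) * ∑ j ∈ Finset.Ico k (k + d), poisson B A (X j)|
        ≤ d * (Dc n C * (1 / (m : ℝ)) ^ 2) := by
    intro d
    induction d with
    | zero => intro _; simp
    | succ d ih =>
      intro hd
      have h1 := ih (by omega)
      have h2 := h.brk hm hA hB (k := k + d) (by omega) (by omega)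
      rw [← add_assoc, Finset.sum_Ico_succ_top (by omega)]
      push_cast
      rw [abs_le] at *
      constructor <;> linarith
  obtain ⟨d, rfl⟩ := Nat.exists_eq_add_of_le hkl
  refine (key d hl).trans ?_
  have hm' : (0 : ℝ) < m := by exact_mod_cast hm
  have hd : (d : ℝ) ≤ m := by exact_mod_cast (by omega : d ≤ m)
  calc (d : ℝ) * (Dc n C * (1 / (m : ℝ)) ^ 2)
      ≤ m * (Dc n C * (1 / (m : ℝ)) ^ 2) := by gcongr
    _ = Dc n C / m := by field_simp

/-- Three block Hamiltonian. -/
noncomputable def Hm (N m : ℕ) (A₁ A₂ A₃ : Phase n → ℝ) : ZMod N → Phase n → ℝ := fun j x =>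
  if j.val < m then 1 / (m : ℝ) * A₁ x else if j.val < 2 * m then 1 / (m : ℝ) * A₂ x
  else 1 / (m : ℝ) * A₃ x

variable {N : ℕ} [NeZero N]

lemma zsum_range (f : ZMod N → ℝ) : ∑ j, f j = ∑ k ∈ Finset.range N, f (k : ZMod N) := by
  refine (Finset.sum_nbij (fun k : ℕ => (k : ZMod N)) ?_ ?_ ?_ ?_).symm
  · intro a _; simp
  · intro a ha b hb hab
    simp only [Finset.coe_range, Set.mem_Iio] at ha hb
    have := congrArg ZMod.val hab
    simpa [ZMod.val_natCast_of_lt ha, ZMod.val_natCast_of_lt hb] using this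
  · intro j _
    exact ⟨j.val, by simpa using ZMod.val_lt j, by simp⟩
  · intro a _; rfl

lemma Hm_sum {m : ℕ} (hN : N = 3 * m) (A₁ A₂ A₃ : Phase n → ℝ) (x : Lp n N) :
    ∑ j, Hm N m A₁ A₂ A₃ j (x j) = 1 / (m : ℝ) * ∑ k ∈ Finset.range m,
      (A₁ (x (k : ℕ)) + A₂ (x ((m + k : ℕ) : ZMod N)) + A₃ (x ((2 * m + k : ℕ) : ZMod N))) := by
  rw [zsum_range]
  have e : Finset.range N = Finset.range (m + m + m) := by rw [hN]; congr 1; ring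
  rw [e, Finset.sum_range_add, Finset.sum_range_add]
  rw [← Finset.sum_add_distrib, ← Finset.sum_add_distrib, Finset.mul_sum]
  refine Finset.sum_congr rfl fun k hk => ?_
  rw [Finset.mem_range] at hk
  unfold Hm
  rw [ZMod.val_natCast_of_lt (by omega), ZMod.val_natCast_of_lt (by omega),
    ZMod.val_natCast_of_lt (by omega), if_pos hk, if_neg (by omega), if_pos (by omega),
    if_neg (by omega), if_neg (by omega), two_mul]
  ring

end CV

namespace CV
set_option linter.unusedSectionVars false
variable {n N : ℕ} [NeZero N]

lemma Hm_fn (m : ℕ) (A₁ A₂ A₃ : Phase n → ℝ) (j : ZMod N) :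
    Hm N m A₁ A₂ A₃ j = fun x => 1 / (m : ℝ) *
      (if j.val < m then A₁ else if j.val < 2 * m then A₂ else A₃) x := by
  funext x; unfold Hm; split_ifs <;> rfl

lemma Hm_add_smul (m : ℕ) (A₁ A₂ A₃ B₁ B₂ B₃ : Phase n → ℝ) (τ : ℝ) :
    (fun (j : ZMod N) x => Hm N m A₁ A₂ A₃ j x + τ * Hm N m B₁ B₂ B₃ j x)
      = Hm N m (fun x => A₁ x + τ * B₁ x) (fun x => A₂ x + τ * B₂ x) (fun x => A₃ x + τ * B₃ x) := by
  funext j x; unfold Hm; split_ifs <;> ring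

lemma ite_Bd {m : ℕ} {C : ℝ} {A₁ A₂ A₃ : Phase n → ℝ} (h₁ : Bd C A₁) (h₂ : Bd C A₂) (h₃ : Bd C A₃)
    (j : ZMod N) : Bd C (if j.val < m then A₁ else if j.val < 2 * m then A₂ else A₃) := by
  split_ifs <;> assumption

lemma Hm_Bd {m : ℕ} (hm : 0 < m) {C : ℝ} {A₁ A₂ A₃ : Phase n → ℝ} (h₁ : Bd C A₁) (h₂ : Bd C A₂)
    (h₃ : Bd C A₃) (j : ZMod N) : Bd C (Hm N m A₁ A₂ A₃ j) := by
  rw [Hm_fn]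
  refine (ite_Bd h₁ h₂ h₃ j).smul ?_
  have hm1 : (1 : ℝ) ≤ m := by exact_mod_cast hm
  rw [abs_of_nonneg (by positivity), div_le_one (by linarith)]; exact hm1

lemma Hm_step {m : ℕ} (hm : 0 < m) {C : ℝ} {A₁ A₂ A₃ : Phase n → ℝ} (h₁ : Bd C A₁) (h₂ : Bd C A₂)
    (h₃ : Bd C A₃) {x : Lp n N} (hx : NearCrit (Hm N m A₁ A₂ A₃) (1 / (m : ℝ) ^ 2) x)
    (j : ZMod N) : ‖x (j + 1) - x j‖ ≤ (C + 1) / m := by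
  have hC := h₁.nonneg
  have hm1 : (1 : ℝ) ≤ m := by exact_mod_cast hm
  refine norm_phase_le (by positivity) fun i => ?_
  have a1 := (hx j i).1
  have a2 := (hx (j + 1) i).2
  have hp : ∀ j, |pderivP (Hm N m A₁ A₂ A₃ j) i (x j)| ≤ 1 / (m : ℝ) * C := by
    intro j
    have := ite_Bd (m := m) h₁ h₂ h₃ j
    rw [Hm_fn, pderivP_mul this.diff, abs_mul, abs_of_nonneg (by positivity : (0 : ℝ) ≤ 1 / (m : ℝ))]
    exact mul_le_mul_of_nonneg_left (this.dp i _) (by positivity)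
  have hq : ∀ j, |pderivQ (Hm N m A₁ A₂ A₃ j) i (x j)| ≤ 1 / (m : ℝ) * C := by
    intro j
    have := ite_Bd (m := m) h₁ h₂ h₃ j
    rw [Hm_fn, pderivQ_mul this.diff, abs_mul, abs_of_nonneg (by positivity : (0 : ℝ) ≤ 1 / (m : ℝ))]
    exact mul_le_mul_of_nonneg_left (this.dq i _) (by positivity)
  have b1 := hp j
  have b2 := hq (j + 1)
  have e1 : 1 / (m : ℝ) ^ 2 ≤ 1 / m := by
    apply one_div_le_one_div_of_le (by linarith); nlinarith
  have e2 : (C + 1) / m = 1 / (m : ℝ) * C + 1 / m := by ring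
  rw [e2]
  unfold gP at a1
  unfold gQ at a2
  rw [add_sub_cancel_right] at a2
  simp only [Prod.fst_sub, Prod.snd_sub, Pi.sub_apply]
  rw [abs_lt] at a1 a2
  rw [abs_le] at b1 b2
  exact ⟨abs_le.2 ⟨by linarith, by linarith⟩, abs_le.2 ⟨by linarith, by linarith⟩⟩

lemma Hm_orb {m : ℕ} {A₁ A₂ A₃ : Phase n → ℝ}
    {x : Lp n N} (hx : NearCrit (Hm N m A₁ A₂ A₃) (1 / (m : ℝ) ^ 2) x)
    {A : Phase n → ℝ} (hA : Differentiable ℝ A) {lo : ℕ}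
    (hAj : ∀ k, lo ≤ k → k < lo + m → (if (k : ZMod N).val < m then A₁ else if (k : ZMod N).val < 2 * m then A₂ else A₃) = A) :
    Orb (fun k => x (k : ZMod N)) A m lo (lo + m) := by
  intro k hk hk' i
  have a1 := (hx (k : ZMod N) i).1
  have a2 := (hx ((k + 1 : ℕ) : ZMod N) i).2
  unfold gP at a1
  unfold gQ at a2
  rw [Hm_fn, hAj k hk (by omega), pderivP_mul hA] at a1
  rw [Hm_fn, hAj (k + 1) (by omega) (by omega), pderivQ_mul hA] at a2
  have e : (((k + 1 : ℕ) : ZMod N)) - 1 = (k : ZMod N) := by push_cast; ring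
  have e' : (((k + 1 : ℕ) : ZMod N)) = (k : ZMod N) + 1 := by push_cast; ring
  rw [e] at a2
  rw [← e'] at a1
  exact ⟨a1.le, a2.le⟩

lemma Hm_orbs {m : ℕ} (hN : N = 3 * m) {C : ℝ} {A₁ A₂ A₃ : Phase n → ℝ}
    (h₁ : Bd C A₁) (h₂ : Bd C A₂) (h₃ : Bd C A₃)
    {x : Lp n N} (hx : NearCrit (Hm N m A₁ A₂ A₃) (1 / (m : ℝ) ^ 2) x) :
    Orb (fun k => x (k : ZMod N)) A₁ m 0 (0 + m) ∧ Orb (fun k => x (k : ZMod N)) A₂ m m (m + m) ∧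
    Orb (fun k => x (k : ZMod N)) A₃ m (2 * m) (2 * m + m) := by
  refine ⟨Hm_orb hx h₁.diff ?_, Hm_orb hx h₂.diff ?_, Hm_orb hx h₃.diff ?_⟩
  · intro k hk hk'
    rw [ZMod.val_natCast_of_lt (by omega), if_pos (by omega)]
  · intro k hk hk'
    rw [ZMod.val_natCast_of_lt (by omega), if_neg (by omega), if_pos (by omega)]
  · intro k hk hk'
    rw [ZMod.val_natCast_of_lt (by omega), if_neg (by omega), if_neg (by omega)]

lemma poisson_mul_right {A B : Phase n → ℝ} (hB : Differentiable ℝ B) (τ : ℝ) (x : Phase n) :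
    poisson A (fun x => τ * B x) x = τ * poisson A B x := by
  unfold poisson
  rw [Finset.mul_sum]
  refine Finset.sum_congr rfl fun i _ => ?_
  rw [pderivP_mul hB, pderivQ_mul hB]; ring

lemma poisson_self (A : Phase n → ℝ) (x : Phase n) : poisson A A x = 0 := by
  unfold poisson
  exact Finset.sum_eq_zero fun i _ => by ring

lemma poisson_anti (A B : Phase n → ℝ) (x : Phase n) : poisson A B x = - poisson B A x := by
  unfold poisson
  rw [← Finset.sum_neg_distrib]
  exact Finset.sum_congr rfl fun i _ => by ring

/-- Energy conservation. -/
lemma energy {m : ℕ} (hm : 0 < m) (hN : N = 3 * m) {C σ : ℝ} (hσ : |σ| ≤ 1)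
    {A₁ F : Phase n → ℝ} (h₁ : Bd C A₁) (hF : Bd C F)
    {x : Lp n N} (hx : NearCrit (Hm N m A₁ (fun x => σ * F x) (fun x => (-σ) * F x)) (1 / (m : ℝ) ^ 2) x)
    {k l : ℕ} (hk : k < m) (hl : l < m) :
    |F (x ((m + k : ℕ) : ZMod N)) - F (x ((2 * m + l : ℕ) : ZMod N))|
      ≤ (2 * Dc n C + C * (C + 1)) / m := by
  have h2 : Bd C (fun x => σ * F x) := hF.smul hσ
  have h3 : Bd C (fun x => (-σ) * F x) := hF.smul (by simpa using hσ)
  obtain ⟨-, o2, o3⟩ := Hm_orbs hN h₁ h2 h3 hx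
  have t2 := o2.tele hm h2 hF (k := m + k) (l := 2 * m - 1) (by omega) (by omega) (by omega)
  have t3 := o3.tele hm h3 hF (k := 2 * m) (l := 2 * m + l) (by omega) (by omega) (by omega)
  have st := Hm_step hm h₁ h2 h3 hx ((2 * m - 1 : ℕ) : ZMod N)
  have e : ((2 * m - 1 : ℕ) : ZMod N) + 1 = ((2 * m : ℕ) : ZMod N) := by
    rw [← Nat.cast_succ]; congr 1; omega
  rw [e] at st
  have b := hF.lip (x ((2 * m : ℕ) : ZMod N)) (x ((2 * m - 1 : ℕ) : ZMod N))
  have hC := hF.nonneg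
  have b' := b.trans (mul_le_mul_of_nonneg_left st hC)
  simp only [poisson_mul_right hF.diff, poisson_self, mul_zero, Finset.sum_const_zero, sub_zero] at t2 t3
  have e2 : (2 * Dc n C + C * (C + 1)) / m = Dc n C / m + Dc n C / m + C * ((C + 1) / m) := by ring
  rw [e2]
  rw [abs_le] at *
  constructor <;> linarith

/-- The displacement argument: orbits cannot visit the support of `K`. -/
lemma displ {m : ℕ} (hm : 0 < m) (hN : N = 3 * m) {C C₀ r R s a e₀ δ τ θ : ℝ} (hτ : |τ| ≤ 1)
    (hs0 : 0 ≤ s) (hs : s ≤ 1) (hθ : |θ| = 1)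
    {K F G F' G' : Phase n → ℝ} {x₀ : Phase n} (hKr : Bd r K) (hKs : ∀ y, K y ≠ 0 → ‖y - x₀‖ ≤ r)
    (hsF : Bd (R / 4) (fun x => (-s) * F x)) (hF : Bd C F) (hG₀ : Bd C₀ G)
    (hG : Bd C G) (hF' : Bd C F') (hG' : Bd C G') (hrC : r ≤ C)
    (hr : r ≤ R / 8) (ha : 0 ≤ a) (hsgn : ∀ y, ‖y - x₀‖ ≤ R → a ≤ θ * poisson G F y)
    (he : ∀ y, |poisson G' F' y| ≤ e₀) (hδ : ∀ y, |G' y - G y| ≤ δ)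
    (hm1 : (C + 3) / m ≤ R / 4)
    (hm2 : (a + 2 * Dc n C + 2 * (C * (C + 1)) + C₀ * (C + 3)) / m
      < s * a - s * e₀ - 2 * δ - 4 * r * C₀)
    {x : Lp n N}
    (hx : NearCrit (Hm N m (fun x => τ * K x) (fun x => s * F' x) (fun x => (-s) * F x)) (1 / (m : ℝ) ^ 2) x)
    {k : ℕ} (hk : k < m) : K (x (k : ZMod N)) = 0 := by
  by_contra hne
  have hm' : (1 : ℝ) ≤ m := by exact_mod_cast hm
  have hC := hF.nonneg
  have hC₀ := hG₀.nonneg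
  have hs1 : |s| ≤ 1 := by rwa [abs_of_nonneg hs0]
  have hs2 : |-s| ≤ 1 := by rwa [abs_neg]
  have h1r : Bd r (fun x => τ * K x) := hKr.smul hτ
  have h1 := h1r.mono hrC
  have h2 : Bd C (fun x => s * F' x) := hF'.smul hs1
  have h3 : Bd C (fun x => (-s) * F x) := hF.smul hs2
  obtain ⟨o1, o2, o3⟩ := Hm_orbs hN h1 h2 h3 hx
  have hk0 := hKs _ hne
  have hst := Hm_step hm h1 h2 h3 hx
  have hcast : ∀ k : ℕ, 0 < k → ((k - 1 : ℕ) : ZMod N) + 1 = (k : ZMod N) := by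
    intro k hk; rw [← Nat.cast_succ]; congr 1; omega
  have st1 := hst ((m - 1 : ℕ) : ZMod N)
  have st2 := hst ((2 * m - 1 : ℕ) : ZMod N)
  have st3 := hst ((3 * m - 1 : ℕ) : ZMod N)
  have h30 : ((3 * m : ℕ) : ZMod N) = ((0 : ℕ) : ZMod N) := by rw [← hN]; simp
  rw [hcast _ (by omega)] at st1 st2 st3
  rw [h30] at st3
  -- block one
  have d0 := o1.dist hm h1r (k := 0) (l := k) le_rfl (Nat.zero_le _) (by omega)
  have d1 := o1.dist hm h1r (k := k) (l := m - 1) (Nat.zero_le _) (by omega) (by omega)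
  -- block two
  have t2 := o2.tele hm h2 hG' (k := m) (l := 2 * m - 1) (by omega) (by omega) (by omega)
  have t3 := o3.tele hm h3 hG (k := 2 * m) (l := 3 * m - 1) (by omega) (by omega) (by omega)
  have d3 : ∀ l, 2 * m ≤ l → l < 3 * m → _ := fun l hl hl' =>
    o3.dist hm hsF (k := l) (l := 3 * m - 1) hl (by omega) (by omega)
  set X : ℕ → Phase n := fun k => x (k : ZMod N) with hX
  have hXk : ∀ k : ℕ, x (k : ZMod N) = X k := fun _ => rfl
  simp only [hXk] at hk0 st1 st2 st3 d0 d1 t2 t3 d3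
  have x0 : ‖X 0 - x₀‖ ≤ 2 * r + 1 / m := by
    have := norm_sub_le_norm_sub_add_norm_sub (X 0) (X k) x₀
    rw [norm_sub_rev] at d0
    linarith
  have xm0 : ‖X 0 - X m‖ ≤ 4 * r + (C + 3) / m := by
    have a1 := norm_sub_le_norm_sub_add_norm_sub (X 0) x₀ (X m)
    have a2 := norm_sub_le_norm_sub_add_norm_sub x₀ (X k) (X m)
    have a3 := norm_sub_le_norm_sub_add_norm_sub (X k) (X (m - 1)) (X m)
    rw [norm_sub_rev] at d1 st1 hk0
    have e : (C + 3) / (m : ℝ) = (C + 1) / m + 1 / m + 1 / m := by ring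
    linarith
  have gm0 : |G (X 0) - G (X m)| ≤ 4 * r * C₀ + C₀ * (C + 3) / m := by
    refine (hG₀.lip _ _).trans ((mul_le_mul_of_nonneg_left xm0 hC₀).trans (le_of_eq ?_))
    ring
  have x3 : ∀ l, 2 * m ≤ l → l < 3 * m → ‖X l - x₀‖ ≤ R := by
    intro l hl hl'
    have hR := hsF.nonneg
    have a1 := d3 l hl hl'
    have a2 := norm_sub_le_norm_sub_add_norm_sub (X l) (X (3 * m - 1)) x₀
    have a3 := norm_sub_le_norm_sub_add_norm_sub (X (3 * m - 1)) (X 0) x₀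
    rw [norm_sub_rev] at a1 st3
    have e : (C + 3) / (m : ℝ) = (C + 1) / m + 1 / m + 1 / m := by ring
    linarith
  -- block two estimate
  have s2 : |1 / (m : ℝ) * ∑ j ∈ Finset.Ico m (2 * m - 1), poisson G' (fun x => s * F' x) (X j)| ≤ s * e₀ := by
    have he0 : 0 ≤ e₀ := (abs_nonneg _).trans (he 0)
    rw [abs_mul, abs_of_nonneg (by positivity : (0 : ℝ) ≤ 1 / (m : ℝ))]
    have : |∑ j ∈ Finset.Ico m (2 * m - 1), poisson G' (fun x => s * F' x) (X j)| ≤ m * (s * e₀) := by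
      refine (Finset.abs_sum_le_sum_abs _ _).trans ?_
      have : ∀ j ∈ Finset.Ico m (2 * m - 1), |poisson G' (fun x => s * F' x) (X j)| ≤ s * e₀ := by
        intro j _
        rw [poisson_mul_right hF'.diff, abs_mul, abs_of_nonneg hs0]
        exact mul_le_mul_of_nonneg_left (he _) hs0
      refine (Finset.sum_le_sum this).trans ?_
      simp only [Finset.sum_const, Nat.card_Ico, nsmul_eq_mul]
      have : ((2 * m - 1 - m : ℕ) : ℝ) ≤ m := by exact_mod_cast (by omega)
      gcongr
    calc _ ≤ 1 / (m : ℝ) * (m * (s * e₀)) := by gcongr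
      _ = s * e₀ := by field_simp
  -- block three estimate
  have s3 : s * a - a / m ≤ - θ * (1 / (m : ℝ) * ∑ j ∈ Finset.Ico (2 * m) (3 * m - 1), poisson G (fun x => (-s) * F x) (X j)) := by
    have e : - θ * (1 / (m : ℝ) * ∑ j ∈ Finset.Ico (2 * m) (3 * m - 1), poisson G (fun x => (-s) * F x) (X j))
      = 1 / (m : ℝ) * ∑ j ∈ Finset.Ico (2 * m) (3 * m - 1), s * (θ * poisson G F (X j)) := by
      rw [Finset.mul_sum, Finset.mul_sum, Finset.mul_sum]
      refine Finset.sum_congr rfl fun j _ => ?_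
      rw [poisson_mul_right hF.diff]; ring
    rw [e]
    have : ∀ j ∈ Finset.Ico (2 * m) (3 * m - 1), s * a ≤ s * (θ * poisson G F (X j)) := by
      intro j hj
      rw [Finset.mem_Ico] at hj
      exact mul_le_mul_of_nonneg_left (hsgn _ (x3 j hj.1 (by omega))) hs0
    have h4 := Finset.sum_le_sum this
    simp only [Finset.sum_const, Nat.card_Ico, nsmul_eq_mul] at h4
    have h5 : ((3 * m - 1 - 2 * m : ℕ) : ℝ) = m - 1 := by
      rw [show 3 * m - 1 - 2 * m = m - 1 by omega, Nat.cast_sub hm]; simp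
    rw [h5] at h4
    refine le_trans ?_ (mul_le_mul_of_nonneg_left h4 (by positivity))
    have h6 : 1 / (m : ℝ) * ((m - 1) * (s * a)) = s * a - (s * a) / m := by field_simp
    rw [h6]
    have : s * a / m ≤ a / m := by gcongr; nlinarith
    linarith
  -- conclusion
  have b2 := (hG.lip _ _).trans (mul_le_mul_of_nonneg_left st2 hC)
  have b3 := (hG.lip _ _).trans (mul_le_mul_of_nonneg_left st3 hC)
  have δ1 := hδ (X m)
  have δ2 := hδ (X (2 * m - 1))
  have eD : (a + 2 * Dc n C + 2 * (C * (C + 1)) + C₀ * (C + 3)) / (m : ℝ)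
     = a / m + 2 * (Dc n C / m) + 2 * (C * ((C + 1) / m)) + C₀ * (C + 3) / m := by ring
  rw [eD] at hm2
  rcases (abs_eq (by norm_num : (0 : ℝ) ≤ 1)).1 hθ with rfl | rfl
  · rw [abs_le] at *
    linarith
  · rw [abs_le] at *
    linarith

end CV

namespace CV
set_option linter.unusedSectionVars false
variable {n N : ℕ} [NeZero N]

lemma Bd.scale {C : ℝ} {B : Phase n → ℝ} (hB : Bd C B) (t : ℝ) :
    Bd (|t| * C) (fun x => t * B x) := by
  have hC := hB.nonneg
  have key : ∀ {u c : ℝ}, |u| ≤ c → |t * u| ≤ |t| * c := by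
    intro u c h; rw [abs_mul]; gcongr
  refine ⟨contDiff_const.mul hB.smooth, by positivity, fun x => key (hB.bd x), ?_, ?_, ?_, ?_, ?_, ?_⟩
  · intro x y; rw [← mul_sub, mul_assoc]; exact key (hB.lip x y)
  · intro i x; rw [pderivP_mul hB.diff]; exact key (hB.dp i x)
  · intro i x; rw [pderivQ_mul hB.diff]; exact key (hB.dq i x)
  · intro i x y; rw [pderivP_mul hB.diff, pderivP_mul hB.diff, ← mul_sub, mul_assoc]
    exact key (hB.lp i x y)
  · intro i x y; rw [pderivQ_mul hB.diff, pderivQ_mul hB.diff, ← mul_sub, mul_assoc]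
    exact key (hB.lq i x y)
  · intro x w
    have hl : lin (fun x => t * B x) x w = t * lin B x w := by
      unfold lin
      rw [Finset.mul_sum]
      refine Finset.sum_congr rfl fun i _ => ?_
      rw [pderivP_mul hB.diff, pderivQ_mul hB.diff]; ring
    rw [hl, ← mul_sub, ← mul_sub, mul_assoc]; exact key (hB.tay x w)

lemma sum_avg_le {m : ℕ} (hm : 0 < m) {f : ℕ → ℝ} {c : ℝ} (h : ∀ k, k < m → f k ≤ c) :
    1 / (m : ℝ) * ∑ k ∈ Finset.range m, f k ≤ c := by
  have hm' : (0 : ℝ) < m := by exact_mod_cast hm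
  have := Finset.sum_le_sum fun k (hk : k ∈ Finset.range m) => h k (Finset.mem_range.1 hk)
  simp only [Finset.sum_const, Finset.card_range, nsmul_eq_mul] at this
  calc 1 / (m : ℝ) * ∑ k ∈ Finset.range m, f k ≤ 1 / (m : ℝ) * (m * c) := by gcongr
    _ = c := by field_simp

lemma energy_sum {m : ℕ} (hm : 0 < m) (hN : N = 3 * m) {C σ t : ℝ} (hσ : |σ| ≤ 1) (ht : |t| ≤ 1)
    {A₁ F : Phase n → ℝ} (h₁ : Bd C A₁) (hF : Bd C F)
    {x : Lp n N} (hx : NearCrit (Hm N m A₁ (fun x => σ * F x) (fun x => (-σ) * F x)) (1 / (m : ℝ) ^ 2) x) :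
    - ∑ j, Hm N m (fun _ => 0) (fun x => t * F x) (fun x => (-t) * F x) j (x j)
      ≤ (2 * Dc n C + C * (C + 1)) / m := by
  rw [Hm_sum hN, ← mul_neg, ← Finset.sum_neg_distrib]
  refine sum_avg_le hm fun k hk => ?_
  have h := energy hm hN hσ h₁ hF hx hk hk
  set u := F (x ((m + k : ℕ) : ZMod N))
  set v := F (x ((2 * m + k : ℕ) : ZMod N))
  have e : -(0 + t * u + -t * v) = -t * (u - v) := by ring
  rw [e]
  refine (le_abs_self _).trans ?_
  rw [abs_mul, abs_neg]
  nlinarith [abs_nonneg (u - v), abs_nonneg t]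

lemma Hm_cmp {m : ℕ} (hm : 0 < m) (hN : N = 3 * m) {A₁ A₂ A₃ B₂ : Phase n → ℝ} {d : ℝ}
    (h : ∀ y, A₂ y ≤ B₂ y + d) (x : Lp n N) :
    ∑ j, Hm N m A₁ A₂ A₃ j (x j) ≤ ∑ j, Hm N m A₁ B₂ A₃ j (x j) + d := by
  rw [Hm_sum hN, Hm_sum hN, ← sub_le_iff_le_add', ← mul_sub, ← Finset.sum_sub_distrib]
  refine sum_avg_le hm fun k _ => ?_
  have := h (x ((m + k : ℕ) : ZMod N))
  linarith

/-- The chain of deformations. -/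
lemma chain {m : ℕ} (hm : 0 < m) (hN : N = 3 * m) {C C₀ r R s a e₀ δ θ k₀ b η : ℝ}
    (hs0 : 0 ≤ s) (hs : s ≤ 1) (hθ : |θ| = 1)
    {K F G F' G' : Phase n → ℝ} {x₀ : Phase n} (hKr : Bd r K) (hKs : ∀ y, K y ≠ 0 → ‖y - x₀‖ ≤ r)
    (hsF : Bd (R / 4) (fun x => (-s) * F x)) (hF : Bd C F) (hG₀ : Bd C₀ G)
    (hG : Bd C G) (hF' : Bd C F') (hG' : Bd C G') (hrC : r ≤ C)
    (hr : r ≤ R / 8) (ha : 0 ≤ a) (hsgn : ∀ y, ‖y - x₀‖ ≤ R → a ≤ θ * poisson G F y)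
    (he : ∀ y, |poisson G' F' y| ≤ e₀) (hδ : ∀ y, |G' y - G y| ≤ δ) (hδF : ∀ y, |F' y - F y| ≤ δ)
    (hm1 : (C + 3) / m ≤ R / 4)
    (hm2 : (a + 2 * Dc n C + 2 * (C * (C + 1)) + C₀ * (C + 3)) / m
      < s * a - s * e₀ - 2 * δ - 4 * r * C₀)
    (hη : 0 < η) (hm3 : (2 * Dc n C + C * (C + 1)) / m ≤ η)
    (hb : 0 ≤ b) (hb4 : 4 * b ≤ 1) (hK : ∀ x, k₀ - b * ‖x - x₀‖ ^ 2 ≤ K x) :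
    k₀ ≤ 6 * η + 2 * δ := by
  have hm' : (1 : ℝ) ≤ m := by exact_mod_cast hm
  have hC := hF.nonneg
  have hs1 : |s| ≤ 1 := by rwa [abs_of_nonneg hs0]
  have hs2 : |-s| ≤ 1 := by rwa [abs_neg]
  have hδ0 : 0 ≤ δ := (abs_nonneg _).trans (hδ 0)
  have hz : Bd C (fun _ : Phase n => (0 : ℝ)) := Bd.zero.mono hC
  have hKC : Bd C (fun x => (-1) * K x) := (hKr.mono hrC).smul (by simp)
  have hε : (0 : ℝ) < 1 / (m : ℝ) ^ 2 := by positivity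
  have hε1 : (1 : ℝ) / (m : ℝ) ^ 2 ≤ 1 := by
    rw [div_le_one (by positivity)]; nlinarith
  have hτ : ∀ τ ∈ Set.Icc (0 : ℝ) 1, |τ * s| ≤ 1 ∧ |s + τ * (-s)| ≤ 1 ∧ |-τ| ≤ 1 := by
    intro τ ⟨h0, h1⟩
    refine ⟨?_, ?_, ?_⟩
    · rw [abs_of_nonneg (by positivity)]; nlinarith
    · rw [abs_of_nonneg (by nlinarith)]; nlinarith
    · rw [abs_neg, abs_of_nonneg h0]; exact h1
  have r0 : Reach (Hm N m (fun _ : Phase n => (0 : ℝ)) (fun _ => 0) (fun _ => 0)) 0 := by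
    have : Hm N m (fun _ : Phase n => (0 : ℝ)) (fun _ => 0) (fun _ => 0) = fun _ _ => 0 := by
      funext j x; simp [Hm]
    rw [this]; exact Reach_zero
  have r1 := r0.path (Hm_Bd hm hz hz hz) (H₁ := Hm N m (fun _ => 0) (fun x => s * F x) (fun x => (-s) * F x))
    (Hm_Bd hm hz (hF.smul hs1) (hF.smul hs2)) hε hε1 hη (by
      intro τ hτ' x hx
      rw [Hm_add_smul] at hx
      refine (energy_sum hm hN (σ := τ * s) (hτ τ hτ').1 hs1 (A₁ := fun _ => 0) hz hF ?_).trans hm3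
      convert hx using 2
      · funext x; ring
      · funext x; ring
      · funext x; ring)
  have e1 : (fun (j : ZMod N) x => Hm N m (fun _ : Phase n => (0 : ℝ)) (fun _ => 0) (fun _ => 0) j x
      + Hm N m (fun _ => 0) (fun x => s * F x) (fun x => (-s) * F x) j x)
      = Hm N m (fun _ => 0) (fun x => s * F x) (fun x => (-s) * F x) := by
    funext j x; simp [Hm]
  rw [e1] at r1
  have hcomp : ∀ y, s * F y ≤ s * F' y + δ ∧ s * F' y ≤ s * F y + δ := by
    intro y
    have h1 : |s * (F' y - F y)| ≤ δ := by
      rw [abs_mul]; nlinarith [hδF y, abs_nonneg (F' y - F y), abs_nonneg s]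
    rw [abs_le] at h1
    constructor <;> linarith
  have r2 := r1.compare (Hm_cmp hm hN (B₂ := fun x => s * F' x) fun y => (hcomp y).1)
  have r3 := r2.path (Hm_Bd hm hz (hF'.smul hs1) (hF.smul hs2))
    (H₁ := Hm N m (fun x => (-1) * K x) (fun _ => 0) (fun _ => 0))
    (Hm_Bd hm hKC hz hz) hε hε1 hη (by
      intro τ hτ' x hx
      rw [Hm_add_smul] at hx
      rw [Hm_sum hN, ← mul_neg, ← Finset.sum_neg_distrib]
      refine sum_avg_le hm fun k hk => ?_
      have := displ hm hN (τ := -τ) (hτ τ hτ').2.2 hs0 hs hθ hKr hKs hsF hF hG₀ hG hF' hG' hrC hr ha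
        hsgn he hδ hm1 hm2 (x := x) (by
          convert hx using 2
          · funext x; ring
          · funext x; ring
          · funext x; ring) hk
      rw [this]; simpa using hη.le)
  have e3 : (fun (j : ZMod N) x => Hm N m (fun _ : Phase n => (0 : ℝ)) (fun x => s * F' x) (fun x => (-s) * F x) j x
      + Hm N m (fun x => (-1) * K x) (fun _ => 0) (fun _ => 0) j x)
      = Hm N m (fun x => (-1) * K x) (fun x => s * F' x) (fun x => (-s) * F x) := by
    funext j x; unfold Hm; split_ifs <;> ring
  rw [e3] at r3
  have r4 := r3.compare (Hm_cmp hm hN (B₂ := fun x => s * F x) fun y => (hcomp y).2)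
  have r5 := r4.path (Hm_Bd hm hKC (hF.smul hs1) (hF.smul hs2))
    (H₁ := Hm N m (fun _ => 0) (fun x => (-s) * F x) (fun x => (-(-s)) * F x))
    (Hm_Bd hm hz (hF.smul hs2) (hF.smul (by rwa [neg_neg]))) hε hε1 hη (by
      intro τ hτ' x hx
      rw [Hm_add_smul] at hx
      refine (energy_sum hm hN (σ := s + τ * (-s)) (hτ τ hτ').2.1 hs2 (A₁ := fun x => (-1) * K x)
        hKC hF ?_).trans hm3
      convert hx using 2
      · funext x; ring
      · funext x; ring
      · funext x; ring)
  have e5 : (fun (j : ZMod N) x => Hm N m (fun x => (-1) * K x) (fun x => s * F x) (fun x => (-s) * F x) j x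
      + Hm N m (fun _ => 0) (fun x => (-s) * F x) (fun x => (-(-s)) * F x) j x)
      = Hm N m (fun x => (-1) * K x) (fun _ => 0) (fun _ => 0) := by
    funext j x; unfold Hm; split_ifs <;> ring
  rw [e5] at r5
  have hinj : Set.InjOn (fun k : ℕ => (k : ZMod N)) (Finset.range m) := by
    intro a ha b hb hab
    simp only [Finset.coe_range, Set.mem_Iio] at ha hb
    have := congrArg ZMod.val hab
    simpa [ZMod.val_natCast_of_lt (show a < N by omega), ZMod.val_natCast_of_lt (show b < N by omega)] using this
  have := r5.lower hb hb4 hK hm hN (S := (Finset.range m).image (fun k : ℕ => (k : ZMod N)))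
    (by rw [Finset.card_image_of_injOn hinj]; simp) (by
      intro x
      rw [Hm_sum hN, Finset.sum_image hinj, neg_mul, ← mul_neg, ← Finset.sum_neg_distrib]
      congr 1
      exact Finset.sum_congr rfl fun k _ => by ring)
  linarith

lemma Bd.continuous_poisson {C C' : ℝ} {A B : Phase n → ℝ} (hA : Bd C A) (hB : Bd C' B) :
    Continuous (poisson A B) := by
  unfold poisson
  refine continuous_finsetSum _ fun i _ => ?_
  exact ((hA.contDiff_pderivQ i).continuous.mul (hB.contDiff_pderivP i).continuous).sub
    ((hA.contDiff_pderivP i).continuous.mul (hB.contDiff_pderivQ i).continuous)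

lemma le_unif {f : Phase n → ℝ} {c : ℝ} (h : ∀ x, |f x| ≤ c) (x : Phase n) : |f x| ≤ unif f :=
  le_ciSup (f := fun x => |f x|) ⟨c, by rintro _ ⟨y, rfl⟩; exact h y⟩ x

lemma Bd.poisson_le {C : ℝ} {A B : Phase n → ℝ} (hA : Bd C A) (hB : Bd C B) (x : Phase n) :
    |poisson A B x| ≤ ∑ _i : Fin n, (C * C + C * C) := by
  unfold poisson
  refine (Finset.abs_sum_le_sum_abs _ _).trans (Finset.sum_le_sum fun i _ => ?_)
  refine (abs_sub _ _).trans ?_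
  rw [abs_mul, abs_mul]
  have hC := hA.nonneg
  exact add_le_add (mul_le_mul (hA.dq i x) (hB.dp i x) (abs_nonneg _) hC)
    (mul_le_mul (hA.dp i x) (hB.dq i x) (abs_nonneg _) hC)

lemma rigid (F G : Phase n → ℝ)
    (hF : SmoothCpt F) (hG : SmoothCpt G)
    (hFG : ¬ ∀ x, poisson F G x = 0) :
    ∃ ε > (0 : ℝ), ∃ δ > (0 : ℝ), ∀ F' G' : Phase n → ℝ,
      SmoothCpt F' → SmoothCpt G' →
      unif (fun x => F' x - F x) < δ → unif (fun x => G' x - G x) < δ →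
      ε ≤ unif (poisson F' G') := by
  push Not at hFG
  obtain ⟨x₀, hx₀⟩ := hFG
  obtain ⟨CF, hCF⟩ := SmoothCpt.exists_bd hF
  obtain ⟨CG, hCG⟩ := SmoothCpt.exists_bd hG
  obtain ⟨C₀, hC₀F, hC₀G⟩ : ∃ C₀, Bd C₀ F ∧ Bd C₀ G :=
    ⟨max CF CG, hCF.mono (le_max_left _ _), hCG.mono (le_max_right _ _)⟩
  have hC₀ := hC₀F.nonneg
  -- sign and size of the bracket
  obtain ⟨θ, a, hθ, ha, hθa⟩ : ∃ θ a : ℝ, |θ| = 1 ∧ 0 < a ∧ θ * poisson G F x₀ = 2 * a := by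
    have hne : poisson G F x₀ ≠ 0 := by rw [poisson_anti]; simpa using hx₀
    rcases lt_or_gt_of_ne hne with h | h
    · exact ⟨-1, - poisson G F x₀ / 2, by simp, by linarith, by ring⟩
    · exact ⟨1, poisson G F x₀ / 2, by simp, by linarith, by ring⟩
  obtain ⟨R, hR, hsgn⟩ : ∃ R > 0, ∀ y, ‖y - x₀‖ ≤ R → a ≤ θ * poisson G F y := by
    have hc : Continuous fun y => θ * poisson G F y :=
      continuous_const.mul (hC₀G.continuous_poisson hC₀F)
    obtain ⟨R', hR', h⟩ := Metric.continuous_iff.1 hc x₀ a ha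
    refine ⟨R' / 2, by linarith, fun y hy => ?_⟩
    have := h y (by rw [dist_eq_norm]; linarith)
    rw [Real.dist_eq, abs_lt] at this
    linarith
  obtain ⟨s, hs0, hs1, hsR⟩ : ∃ s : ℝ, 0 < s ∧ s ≤ 1 ∧ s * C₀ ≤ R / 4 := by
    refine ⟨min 1 (R / (4 * (C₀ + 1))), by positivity, min_le_left _ _, ?_⟩
    calc _ ≤ R / (4 * (C₀ + 1)) * (C₀ + 1) := by
          gcongr
          · exact min_le_right _ _
          · linarith
      _ = R / 4 := by field_simp
  have hsa : 0 < s * a := by positivity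
  obtain ⟨r, hr0, hrR, hrC⟩ : ∃ r : ℝ, 0 < r ∧ r ≤ R / 8 ∧ r * C₀ ≤ s * a / 32 := by
    refine ⟨min (R / 8) (s * a / (32 * (C₀ + 1))), by positivity, min_le_left _ _, ?_⟩
    calc _ ≤ s * a / (32 * (C₀ + 1)) * (C₀ + 1) := by
          gcongr
          · exact min_le_right _ _
          · linarith
      _ = s * a / 32 := by field_simp
  -- the bump
  let χ : ContDiffBump x₀ := ⟨r / 2, r, by linarith, by linarith⟩
  obtain ⟨Cχ, hCχ⟩ := SmoothCpt.exists_bd (A := (χ : Phase n → ℝ)) ⟨χ.contDiff, χ.hasCompactSupport⟩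
  have hCχ0 := hCχ.nonneg
  obtain ⟨k₀, hk0, hkr, hkb⟩ : ∃ k₀ : ℝ, 0 < k₀ ∧ k₀ * Cχ ≤ r ∧ k₀ ≤ r ^ 2 / 32 := by
    refine ⟨min (r / (Cχ + 1)) (r ^ 2 / 32), by positivity, ?_, min_le_right _ _⟩
    calc _ ≤ r / (Cχ + 1) * (Cχ + 1) := by
          gcongr
          · exact min_le_left _ _
          · linarith
      _ = r := by field_simp
  have hKr : Bd r (fun x => k₀ * χ x) := by
    have := hCχ.scale k₀
    rw [abs_of_pos hk0] at this
    exact this.mono hkr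
  have hKs : ∀ y, k₀ * χ y ≠ 0 → ‖y - x₀‖ ≤ r := by
    intro y hy
    have h1 : y ∈ Function.support χ := fun h => hy (by rw [h, mul_zero])
    rw [χ.support_eq, Metric.mem_ball, dist_eq_norm] at h1
    exact h1.le
  have hb0 : 0 ≤ 4 * k₀ / r ^ 2 := by positivity
  have hb4 : 4 * (4 * k₀ / r ^ 2) ≤ 1 := by
    rw [← mul_div_assoc, div_le_one (by positivity)]; linarith
  have hK : ∀ x, k₀ - 4 * k₀ / r ^ 2 * ‖x - x₀‖ ^ 2 ≤ k₀ * χ x := by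
    intro x
    by_cases hx : ‖x - x₀‖ ≤ r / 2
    · have : χ x = 1 := χ.one_of_mem_closedBall (by
        rw [Metric.mem_closedBall, dist_eq_norm]; exact hx)
      rw [this]
      have : 0 ≤ 4 * k₀ / r ^ 2 * ‖x - x₀‖ ^ 2 := by positivity
      linarith
    · push Not at hx
      have h1 : 0 ≤ k₀ * χ x := mul_nonneg hk0.le χ.nonneg
      have h2 : 4 * k₀ / r ^ 2 * (r / 2) ^ 2 ≤ 4 * k₀ / r ^ 2 * ‖x - x₀‖ ^ 2 := by gcongr
      have h3 : 4 * k₀ / r ^ 2 * (r / 2) ^ 2 = k₀ := by field_simp; norm_num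
      linarith
  refine ⟨a / 8, by positivity, min (s * a / 32) (k₀ / 8), by positivity, ?_⟩
  intro F' G' hF' hG' hFF hGG
  by_contra hlt
  push Not at hlt
  set δ := min (s * a / 32) (k₀ / 8) with hδdef
  have hδ1 : δ ≤ s * a / 32 := min_le_left _ _
  have hδ2 : δ ≤ k₀ / 8 := min_le_right _ _
  obtain ⟨CF', hCF'⟩ := SmoothCpt.exists_bd hF'
  obtain ⟨CG', hCG'⟩ := SmoothCpt.exists_bd hG'
  have hCF'0 := hCF'.nonneg
  have hCG'0 := hCG'.nonneg
  set C := C₀ + CF' + CG' + r with hCdef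
  have hC : 0 ≤ C := by positivity
  have bF : Bd C F := hC₀F.mono (by linarith)
  have bG : Bd C G := hC₀G.mono (by linarith)
  have bF' : Bd C F' := hCF'.mono (by linarith)
  have bG' : Bd C G' := hCG'.mono (by linarith)
  have hδF : ∀ y, |F' y - F y| ≤ δ := fun y =>
    (le_unif (f := fun x => F' x - F x) (c := C + C) (fun x =>
      (abs_sub _ _).trans (add_le_add (bF'.bd x) (bF.bd x))) y).trans hFF.le
  have hδG : ∀ y, |G' y - G y| ≤ δ := fun y =>
    (le_unif (f := fun x => G' x - G x) (c := C + C) (fun x =>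
      (abs_sub _ _).trans (add_le_add (bG'.bd x) (bG.bd x))) y).trans hGG.le
  have he : ∀ y, |poisson G' F' y| ≤ a / 8 := fun y => by
    rw [poisson_anti, abs_neg]
    exact (le_unif (bF'.poisson_le bG') y).trans hlt.le
  have hD := Dc_nonneg (n := n) hC
  set Z := (C + 3) + (a + 2 * Dc n C + 2 * (C * (C + 1)) + C₀ * (C + 3)) + (2 * Dc n C + C * (C + 1))
    with hZ
  have z1 : 0 ≤ a + 2 * Dc n C + 2 * (C * (C + 1)) + C₀ * (C + 3) := by positivity
  have z2 : 0 ≤ 2 * Dc n C + C * (C + 1) := by positivity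
  obtain ⟨t, ht0, ht1, ht2, ht3⟩ : ∃ t > 0, t ≤ R / 4 ∧ t ≤ s * a / 4 ∧ t ≤ k₀ / 24 :=
    ⟨min (R / 4) (min (s * a / 4) (k₀ / 24)), by positivity, min_le_left _ _,
      (min_le_right _ _).trans (min_le_left _ _), (min_le_right _ _).trans (min_le_right _ _)⟩
  obtain ⟨m, hm⟩ := exists_nat_gt (Z / t)
  have hZ0 : 0 < Z := by rw [hZ]; linarith
  have hm0 : (0 : ℝ) < m := lt_trans (by positivity) hm
  have hmZ : Z / m ≤ t := by
    rw [div_lt_iff₀ ht0] at hm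
    rw [div_le_iff₀ hm0]; linarith
  have hmpos : 0 < m := by exact_mod_cast hm0
  have : NeZero (3 * m) := ⟨by omega⟩
  have hle : ∀ z, z ≤ Z → z / m ≤ t := fun z hz =>
    (div_le_div_of_nonneg_right hz hm0.le).trans hmZ
  have := chain (N := 3 * m) hmpos rfl (C := C) (C₀ := C₀) (r := r) (R := R) (s := s) (a := a)
    (e₀ := a / 8) (δ := δ) (θ := θ) (k₀ := k₀) (b := 4 * k₀ / r ^ 2) (η := k₀ / 24)
    hs0.le hs1 hθ hKr hKs (by
      have := hC₀F.scale (-s)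
      rw [abs_neg, abs_of_pos hs0] at this
      exact this.mono hsR) bF hC₀G bG bF' bG' (by linarith) hrR ha.le hsgn he hδG hδF
    ((hle _ (by linarith)).trans ht1)
    (by
      refine lt_of_le_of_lt ((hle _ (by linarith)).trans ht2) ?_
      nlinarith) (by linarith) ((hle _ (by linarith)).trans ht3) hb0 hb4 hK
  linarith

end CV

/-- **Cardin–Viterbo rigidity.** If `{F,G} ≢ 0`, then there are `ε > 0` and `δ > 0` such
that every pair `F', G' ∈ C_c^∞(ℝ^{2n})` with `‖F'−F‖ < δ` and `‖G'−G‖ < δ` satisfies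
`‖{F',G'}‖ ≥ ε`. -/
theorem cardin_viterbo_rigidity (n : ℕ) (hn : 1 ≤ n) (F G : Phase n → ℝ)
    (hF : SmoothCpt F) (hG : SmoothCpt G)
    (hFG : ¬ ∀ x, poisson F G x = 0) :
    ∃ ε > (0 : ℝ), ∃ δ > (0 : ℝ), ∀ F' G' : Phase n → ℝ,
      SmoothCpt F' → SmoothCpt G' →
      unif (fun x => F' x - F x) < δ → unif (fun x => G' x - G x) < δ →
      ε ≤ unif (poisson F' G') := by
  exact CV.rigid F G hF hG hFG
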